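/- Let k ≥ 1 be an integer. Assume f satisfies (f1), (f2), (f7) and q satisfies (q1), (q2), (q4), (q6), (q7), where the constant C in (f7) is the constant from (q7). Then the bound state problem has at most one solution with positive initial value and exactly k sign changes: if u₁ and u₂ are solutions of (E) with u_i(0) > 0, lim_{r→∞} u_i(r) = 0 and exactly k sign changes in (0,∞) (i = 1,2), then u₁ = u₂. -/

import Mathlib

open Set Filter MeasureTheory Topology

noncomputable section

/-- `F(s) = ∫₀ˢ f(t) dt`. -/
def Fint (f : ℝ → ℝ) (s : ℝ) : ℝ := ∫ t in (0:ℝ)..s, f t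

/-- `s ∈ (−c, c)` where `c ∈ (0, ∞]` is viewed as an extended real. -/
def InCC (c : EReal) (s : ℝ) : Prop := -c < (s : EReal) ∧ (s : EReal) < c

/-- A solution of equation (E):  `u'' + (q'/q) u' + f(u) = 0` on `(0,∞)`,
`u` with values in `(−c,c)`, `C¹` on `[0,∞)`, twice differentiable on `(0,∞)`,
and `u'(0) = 0`. -/
structure IsSolutionE (c : EReal) (f q u : ℝ → ℝ) : Prop where
  mem : ∀ r : ℝ, 0 ≤ r → InCC c (u r)
  c1 : ContDiffOn ℝ 1 u (Ici (0:ℝ))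
  diff2 : ∀ r : ℝ, 0 < r → DifferentiableAt ℝ (deriv u) r
  ode : ∀ r : ℝ, 0 < r →
    deriv (deriv u) r + (deriv q r / q r) * deriv u r + f (u r) = 0
  d0 : deriv u 0 = 0

/-- Condition (f1). -/
def CondF1 (c : EReal) (f : ℝ → ℝ) (b β : ℝ) : Prop :=
  (∀ s : ℝ, f (-s) = - f s) ∧ f 0 = 0 ∧
  0 < b ∧ b < β ∧ (β : EReal) < c ∧
  (∀ s : ℝ, b < s → (s : EReal) < c → 0 < f s) ∧
  (∀ s : ℝ, s ∈ Icc (0:ℝ) b → f s ≤ 0) ∧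
  (∃ s ∈ Icc (0:ℝ) b, f s ≠ 0) ∧
  Fint f β = 0

/-- Condition (f2). -/
def CondF2 (c : EReal) (f : ℝ → ℝ) : Prop :=
  ContDiffOn ℝ 1 f {s : ℝ | 0 < s ∧ (s : EReal) < c} ∧
  IntegrableOn (deriv f) (Ioo (0:ℝ) 1)

/-- Condition (q1). -/
def CondQ1 (q : ℝ → ℝ) : Prop :=
  ContDiffOn ℝ 1 q (Ioi (0:ℝ)) ∧
  (∀ r : ℝ, 0 < r → 0 < q r ∧ 0 < deriv q r) ∧
  q 0 = 0 ∧ ContinuousWithinAt q (Ici (0:ℝ)) 0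

/-- Condition (q2). -/
def CondQ2 (q : ℝ → ℝ) : Prop :=
  StrictAntiOn (fun r => deriv q r / q r) (Ioi (0:ℝ))

/-- `Q(r) = ∫₀ʳ q(s) ds`. -/
def Qint (q : ℝ → ℝ) (r : ℝ) : ℝ := ∫ s in (0:ℝ)..r, q s

/-- `H = (Q/q)'`. -/
def Hfun (q : ℝ → ℝ) (r : ℝ) : ℝ := deriv (fun t => Qint q t / q t) r

/-- Condition (q3), with `Hinf = H∞`. -/
def CondQ3 (q : ℝ → ℝ) (Hinf : ℝ) : Prop :=
  AntitoneOn (Hfun q) (Ioi (0:ℝ)) ∧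
  (∃ H0 : ℝ, Tendsto (Hfun q) (nhdsWithin 0 (Ioi 0)) (nhds H0) ∧ H0 < 1/2) ∧
  Tendsto (Hfun q) atTop (nhds Hinf) ∧ 0 < Hinf ∧
  MonotoneOn (fun r => q r * (Hfun q r - Hinf)) (Ioi (0:ℝ))

/-- Condition (f3). -/
def CondF3 (c : EReal) (f : ℝ → ℝ) (β Hinf : ℝ) : Prop :=
  ∀ s : ℝ, β < s → (s : EReal) < c →
    (1 - 2 * Hinf) / 2 ≤ deriv (fun t => Fint f t / f t) s

/-- `h(r) = q(r) ∫_r^∞ ds / q(s)`. -/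
def hfun (q : ℝ → ℝ) (r : ℝ) : ℝ := q r * ∫ s in Ioi r, 1 / q s

/-- Condition (q4), with `linf = ℓ∞`. -/
def CondQ4 (q : ℝ → ℝ) (linf : ℝ) : Prop :=
  IntegrableOn (fun r => 1 / q r) (Ioi (1:ℝ)) ∧
  ¬ IntegrableOn (fun r => 1 / q r) (Ioo (0:ℝ) 1) ∧
  (∀ r : ℝ, 0 < r → 0 < deriv (hfun q) r) ∧
  AntitoneOn (deriv (hfun q)) (Ioi (0:ℝ)) ∧
  Tendsto (deriv (hfun q)) atTop (nhds linf) ∧ 0 < linf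

/-- Condition (f4): `s ↦ s f'(s)/f(s)` is decreasing for `s ≥ b`. -/
def CondF4 (c : EReal) (f : ℝ → ℝ) (b : ℝ) : Prop :=
  StrictAntiOn (fun s => s * deriv f s / f s) {s : ℝ | b ≤ s ∧ (s : EReal) < c}

/-- Condition (q5). -/
def CondQ5 (q : ℝ → ℝ) : Prop :=
  StrictMonoOn (fun r => deriv q r * q r) (Ioi (0:ℝ))

/-- Condition (f5). -/
def CondF5 (c : EReal) (f : ℝ → ℝ) (b : ℝ) : Prop :=
  ∀ s : ℝ, b ≤ s → (s : EReal) < c → deriv f s * (s - b) ≤ f s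

/-- Condition (f6). -/
def CondF6 (f : ℝ → ℝ) (β linf : ℝ) : Prop :=
  β * deriv f β / f β ≤ 1 + 2 * linf

/-- `G(r) = (q'/(q h)) ∫₀ʳ h − 1/2`. -/
def Gfun (q : ℝ → ℝ) (r : ℝ) : ℝ :=
  deriv q r / (q r * hfun q r) * (∫ s in (0:ℝ)..r, hfun q s) - 1/2

/-- Condition (q6), with `Gbar = sup_{r>0} G(r)`. -/
def CondQ6 (q : ℝ → ℝ) (Gbar : ℝ) : Prop :=
  (∀ r : ℝ, 0 < r → 0 ≤ Gfun q r) ∧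
  IsLUB (Gfun q '' Ioi (0:ℝ)) Gbar ∧
  MonotoneOn (fun r => Gfun q r * hfun q r / Real.sqrt (∫ s in (0:ℝ)..r, hfun q s))
    (Ioi (0:ℝ))

/-- Condition (q7), with constant `C`. -/
def CondQ7 (q : ℝ → ℝ) (Gbar C : ℝ) : Prop :=
  Gbar ≤ C ∧ C ≤ 1 ∧
  ∃ a : ℝ, a ∈ Ioo (0:ℝ) 1 ∧
    MonotoneOn (fun r => hfun q r ^ (1 - a) * (C - Gfun q r)) (Ioi (0:ℝ))

/-- Condition (f7). -/
def CondF7 (c : EReal) (f : ℝ → ℝ) (β C : ℝ) : Prop :=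
  ∀ s : ℝ, β < s → (s : EReal) < c → C ≤ deriv (fun t => Fint f t / f t) s

/-- `u` has exactly `k` sign changes on `(0,∞)`: there are
`0 = z₀ < z₁ < ⋯ < z_k` such that for `i = 0,…,k` the function `(−1)^i u`
is nonnegative and not identically zero on `[z_i, z_{i+1}]` (with `z_{k+1} = ∞`). -/
def ExactSignChanges (u : ℝ → ℝ) (k : ℕ) : Prop :=
  ∃ z : ℕ → ℝ, z 0 = 0 ∧ (∀ i, i < k → z i < z (i + 1)) ∧
    ∀ i, i ≤ k →
      (∀ r ∈ (if i < k then Icc (z i) (z (i + 1)) else Ici (z i)),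
        0 ≤ (-1 : ℝ) ^ i * u r) ∧
      ∃ r ∈ (if i < k then Icc (z i) (z (i + 1)) else Ici (z i)),
        (-1 : ℝ) ^ i * u r ≠ 0

/-- A first variation `φ` along a solution `u` of (E). -/
structure IsFirstVariation (c : EReal) (f q u φ : ℝ → ℝ) : Prop where
  c1 : ContDiffOn ℝ 1 φ (Ici (0:ℝ))
  init : φ 0 = 1
  dinit : deriv φ 0 = 0
  diff2 : ∀ r : ℝ, 0 < r → u r ≠ 0 → DifferentiableAt ℝ (deriv φ) r
  ode : ∀ r : ℝ, 0 < r → u r ≠ 0 →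
    deriv (deriv φ) r + (deriv q r / q r) * deriv φ r + deriv f (u r) * φ r = 0

/-- The filter of approach to `Z ∈ (0,∞]` from the left. -/
def leftFilter (Z : EReal) : Filter ℝ :=
  if Z = ⊤ then atTop else nhdsWithin Z.toReal (Iio Z.toReal)

/-- `Z₁` for a single solution `w`: the supremum of the radii `r > 0` such that
`w > 0` and `w' < 0 ` on `(0,r)`. -/
def Z1 (w : ℝ → ℝ) : EReal :=
  sSup {z : EReal | ∃ r : ℝ, z = (r : EReal) ∧ 0 < r ∧
    ∀ s : ℝ, 0 < s → s < r → 0 < w s ∧ deriv w s < 0}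

/-- The damping coefficient `q'/q`. -/
def damping (q : ℝ → ℝ) (r : ℝ) : ℝ := deriv q r / q r

/-- `K(r) = ∫₀ʳ h`. -/
def hInt (q : ℝ → ℝ) (r : ℝ) : ℝ := ∫ s in (0:ℝ)..r, hfun q s

/-- `P(r) = ∫_r^∞ 1/q`. -/
def invTail (q : ℝ → ℝ) (r : ℝ) : ℝ := ∫ s in Ioi r, 1 / q s

/-- The consequences of the hypotheses on the weight that drive the comparison argument. -/
structure AdmissibleWeight (q : ℝ → ℝ) (a C : ℝ) : Prop where
  pos : ∀ r, 0 < r → 0 < q r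
  hasDerivAt : ∀ r, 0 < r → HasDerivAt q (deriv q r) r
  continuousOn_deriv : ContinuousOn (deriv q) (Ioi 0)
  zero : q 0 = 0
  continuousOn : ContinuousOn q (Ici 0)
  strictMonoOn : StrictMonoOn q (Ici 0)
  damping_pos : ∀ r, 0 < r → 0 < damping q r
  damping_anti : AntitoneOn (damping q) (Ioi 0)
  invTail_tendsto : Tendsto (invTail q) atTop (𝓝 0)
  h_pos : ∀ r, 0 < r → 0 < hfun q r
  h_hasDerivAt : ∀ r, 0 < r → HasDerivAt (hfun q) (deriv (hfun q) r) r
  h_deriv_pos : ∀ r, 0 < r → 0 < deriv (hfun q) r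
  h_deriv_anti : AntitoneOn (deriv (hfun q)) (Ioi 0)
  h_mono : StrictMonoOn (hfun q) (Ioi 0)
  damping_mul_h : ∀ r, 0 < r → damping q r * hfun q r = deriv (hfun q) r + 1
  K_pos : ∀ r, 0 < r → 0 < hInt q r
  K_hasDerivAt : ∀ r, 0 < r → HasDerivAt (hInt q) (hfun q r) r
  K_mono : StrictMonoOn (hInt q) (Ioi 0)
  K_tendsto : Tendsto (hInt q) (𝓝[>] 0) (𝓝 0)
  ratio_anti : AntitoneOn (fun r => hfun q r / √(hInt q r)) (Ioi 0)
  G_nonneg : ∀ r, 0 < r → 0 ≤ Gfun q r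
  G_le : ∀ r, 0 < r → Gfun q r ≤ C
  G_ratio_mono : MonotoneOn (fun r => Gfun q r * hfun q r / √(hInt q r)) (Ioi 0)
  a_pos : 0 < a
  h_pow_mono : MonotoneOn (fun r => hfun q r ^ (1 - a) * (C - Gfun q r)) (Ioi 0)
  C_le : C ≤ 1

lemma Gfun_eq (q : ℝ → ℝ) (r : ℝ) :
    Gfun q r = damping q r * hInt q r / hfun q r - 1 / 2 := by
  unfold Gfun damping hInt
  rw [div_mul_eq_mul_div, div_mul_eq_mul_div, div_div]

lemma CondQ1.strictMonoOn {q : ℝ → ℝ} (hq : CondQ1 q) : StrictMonoOn q (Ici 0) := by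
  obtain ⟨h1, h2, h3, h4⟩ := hq
  apply strictMonoOn_of_deriv_pos (convex_Ici 0)
  · intro x hx
    rcases eq_or_lt_of_le (mem_Ici.1 hx) with rfl | hx
    · exact h4
    · exact ((h1.contDiffAt (Ioi_mem_nhds hx)).continuousAt).continuousWithinAt
  · intro x hx
    rw [interior_Ici] at hx
    exact (h2 x hx).2

lemma CondQ1.hasDerivAt {q : ℝ → ℝ} (hq : CondQ1 q) {r : ℝ} (hr : 0 < r) :
    HasDerivAt q (deriv q r) r :=
  ((hq.1.contDiffAt (Ioi_mem_nhds hr)).differentiableAt (by norm_num)).hasDerivAt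

lemma CondQ1.continuousOn_inv {q : ℝ → ℝ} (hq : CondQ1 q) :
    ContinuousOn (fun r => 1 / q r) (Ioi 0) := fun r hr =>
  (continuousAt_const.div (hq.hasDerivAt hr).continuousAt (hq.2.1 r hr).1.ne').continuousWithinAt

lemma CondQ1.intervalIntegrable_inv {q : ℝ → ℝ} (hq : CondQ1 q) {x y : ℝ} (hx : 0 < x)
    (hy : 0 < y) : IntervalIntegrable (fun r => 1 / q r) volume x y :=
  (hq.continuousOn_inv.mono fun z hz => by
    exact lt_of_lt_of_le (lt_min hx hy) hz.1).intervalIntegrable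

lemma integrableOn_inv {q : ℝ → ℝ} (hq : CondQ1 q)
    (hi : IntegrableOn (fun r => 1 / q r) (Ioi (1:ℝ))) {r : ℝ} (hr : 0 < r) :
    IntegrableOn (fun r => 1 / q r) (Ioi r) := by
  have h := hq.intervalIntegrable_inv hr one_pos
  rcases le_total r 1 with h1 | h1
  · rw [intervalIntegrable_iff_integrableOn_Ioc_of_le h1] at h
    rw [← Ioc_union_Ioi_eq_Ioi h1]
    exact h.union hi
  · exact hi.mono_set (Ioi_subset_Ioi h1)

lemma invTail_eq {q : ℝ → ℝ} (hq : CondQ1 q)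
    (hi : IntegrableOn (fun r => 1 / q r) (Ioi (1:ℝ))) {r : ℝ} (hr : 0 < r) :
    invTail q r = invTail q 1 - ∫ s in (1:ℝ)..r, 1 / q s := by
  have := intervalIntegral.integral_Ioi_sub_Ioi' (integrableOn_inv hq hi one_pos)
    (integrableOn_inv hq hi hr)
  unfold invTail
  linarith

lemma invTail_hasDerivAt {q : ℝ → ℝ} (hq : CondQ1 q)
    (hi : IntegrableOn (fun r => 1 / q r) (Ioi (1:ℝ))) {r : ℝ} (hr : 0 < r) :
    HasDerivAt (invTail q) (-(1 / q r)) r := by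
  have h1 : HasDerivAt (fun r => invTail q 1 - ∫ s in (1:ℝ)..r, 1 / q s) (-(1 / q r)) r := by
    refine (intervalIntegral.integral_hasDerivAt_right
      (hq.intervalIntegrable_inv one_pos hr) ?_ ?_).const_sub _
    · exact hq.continuousOn_inv.stronglyMeasurableAtFilter isOpen_Ioi r hr
    · exact hq.continuousOn_inv.continuousAt (Ioi_mem_nhds hr)
  refine h1.congr_of_eventuallyEq ?_
  filter_upwards [Ioi_mem_nhds hr] with s hs
  exact invTail_eq hq hi hs

lemma invTail_pos {q : ℝ → ℝ} (hq : CondQ1 q)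
    (hi : IntegrableOn (fun r => 1 / q r) (Ioi (1:ℝ))) {r : ℝ} (hr : 0 < r) :
    0 < invTail q r := by
  unfold invTail
  rw [setIntegral_pos_iff_support_of_nonneg_ae]
  · have : Function.support (fun r => 1 / q r) ∩ Ioi r = Ioi r := by
      apply inter_eq_right.2
      intro s hs
      exact (one_div_pos.2 (hq.2.1 s (hr.trans hs)).1).ne'
    rw [this]
    simp
  · filter_upwards [ae_restrict_mem measurableSet_Ioi] with s hs
    exact (one_div_pos.2 (hq.2.1 s (hr.trans hs)).1).le
  · exact integrableOn_inv hq hi hr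

lemma admissibleWeight {q : ℝ → ℝ} {linf Gbar C : ℝ} (hq1 : CondQ1 q) (hq2 : CondQ2 q)
    (hq4 : CondQ4 q linf) (hq6 : CondQ6 q Gbar) (hq7 : CondQ7 q Gbar C) :
    ∃ a, AdmissibleWeight q a C := by
  obtain ⟨hi, -, h3, h4, -, -⟩ := hq4
  obtain ⟨g1, g2, g3⟩ := hq6
  obtain ⟨c1, c2, a, ha, hmono⟩ := hq7
  have hqpos : ∀ r, 0 < r → 0 < q r := fun r hr => (hq1.2.1 r hr).1
  have hHas : ∀ r, 0 < r →
      HasDerivAt (hfun q) (deriv q r * invTail q r + q r * (-(1 / q r))) r := fun r hr =>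
    (hq1.hasDerivAt hr).mul (invTail_hasDerivAt hq1 hi hr)
  have hpos : ∀ r, 0 < r → 0 < hfun q r := fun r hr =>
    mul_pos (hqpos r hr) (invTail_pos hq1 hi hr)
  have hD : ∀ r, 0 < r → HasDerivAt (hfun q) (deriv (hfun q) r) r := fun r hr => by
    simpa [(hHas r hr).deriv] using hHas r hr
  have hmonoh : StrictMonoOn (hfun q) (Ioi 0) := by
    apply strictMonoOn_of_deriv_pos (convex_Ioi 0)
    · exact fun x hx => (hD x hx).continuousAt.continuousWithinAt
    · intro x hx
      rw [interior_Ioi] at hx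
      exact h3 x hx
  have hcont : ContinuousOn (hfun q) (Ioi 0) :=
    fun x hx => (hD x hx).continuousAt.continuousWithinAt
  have hInteg : ∀ r, 0 < r → IntervalIntegrable (hfun q) volume 0 r := by
    intro r hr
    rw [intervalIntegrable_iff_integrableOn_Ioc_of_le hr.le]
    refine IntegrableOn.of_bound (C := hfun q r) (by simp)
      ((hcont.mono Ioc_subset_Ioi_self).aestronglyMeasurable measurableSet_Ioc) ?_
    · filter_upwards [ae_restrict_mem measurableSet_Ioc] with s hs
      rw [Real.norm_of_nonneg (hpos s hs.1).le]
      exact hmonoh.monotoneOn hs.1 hr hs.2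
  have hKD : ∀ r, 0 < r → HasDerivAt (hInt q) (hfun q r) r := fun r hr =>
    intervalIntegral.integral_hasDerivAt_right (hInteg r hr)
      (hcont.stronglyMeasurableAtFilter isOpen_Ioi r hr) (hcont.continuousAt (Ioi_mem_nhds hr))
  have hKpos : ∀ r, 0 < r → 0 < hInt q r := fun r hr =>
    intervalIntegral.intervalIntegral_pos_of_pos_on (hInteg r hr) (fun x hx => hpos x hx.1) hr
  have hKmono : StrictMonoOn (hInt q) (Ioi 0) := by
    apply strictMonoOn_of_deriv_pos (convex_Ioi 0)
    · exact fun x hx => (hKD x hx).continuousAt.continuousWithinAt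
    · intro x hx
      rw [interior_Ioi] at hx
      rw [(hKD x hx).deriv]
      exact hpos x hx
  have hKle : ∀ r, 0 < r → hInt q r ≤ r * hfun q r := by
    intro r hr
    have := intervalIntegral.integral_mono_on_of_le_Ioo hr.le (hInteg r hr)
      (intervalIntegrable_const (c := hfun q r))
      (fun x hx => hmonoh.monotoneOn hx.1 hr hx.2.le)
    simpa [hInt] using this
  have hKlim : Tendsto (hInt q) (𝓝[>] 0) (𝓝 0) := by
    have hlim : Tendsto (fun r : ℝ => r * hfun q 1) (𝓝[>] 0) (𝓝 0) := by
      have : Tendsto (fun r : ℝ => r * hfun q 1) (𝓝 0) (𝓝 (0 * hfun q 1)) :=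
        (continuous_id.mul continuous_const).tendsto 0
      rw [zero_mul] at this
      exact this.mono_left nhdsWithin_le_nhds
    refine tendsto_of_tendsto_of_tendsto_of_le_of_le' tendsto_const_nhds hlim ?_ ?_
    · filter_upwards [self_mem_nhdsWithin] with r hr using (hKpos r hr).le
    · filter_upwards [Ioo_mem_nhdsGT (zero_lt_one' ℝ)] with r hr
      exact (hKle r hr.1).trans
        (mul_le_mul_of_nonneg_left (hmonoh.monotoneOn hr.1 (mem_Ioi.2 one_pos) hr.2.le) hr.1.le)
  have hdh : ∀ r, 0 < r → damping q r * hfun q r = deriv (hfun q) r + 1 := by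
    intro r hr
    rw [(hHas r hr).deriv]
    have := (hqpos r hr).ne'
    change deriv q r / q r * (q r * invTail q r) = _
    field_simp
    ring
  have key : ∀ r, 0 < r → deriv (hfun q) r * hInt q r ≤ hfun q r ^ 2 / 2 := by
    intro r hr
    have hm : MonotoneOn (fun t => hfun q t ^ 2 / 2 - deriv (hfun q) r * hInt q t) (Ioc 0 r) := by
      apply monotoneOn_of_hasDerivWithinAt_nonneg (convex_Ioc 0 r)
        (f' := fun t => hfun q t * (deriv (hfun q) t - deriv (hfun q) r))
      · intro x hx
        exact (((hD x hx.1).continuousAt.pow 2).div_const 2 |>.sub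
          (continuousAt_const.mul (hKD x hx.1).continuousAt)).continuousWithinAt
      · intro x hx
        rw [interior_Ioc] at hx
        refine HasDerivAt.hasDerivWithinAt ?_
        refine ((((hD x hx.1).pow 2).div_const 2).sub
          ((hKD x hx.1).const_mul (deriv (hfun q) r))).congr_deriv ?_
        push_cast
        ring
      · intro x hx
        rw [interior_Ioc] at hx
        exact mul_nonneg (hpos x hx.1).le (sub_nonneg.2 (h4 hx.1 hr hx.2.le))
    have hl : Tendsto (fun t => - (deriv (hfun q) r * hInt q t)) (𝓝[>] 0) (𝓝 0) := by
      simpa using (hKlim.const_mul (deriv (hfun q) r)).neg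
    have := le_of_tendsto hl (b := hfun q r ^ 2 / 2 - deriv (hfun q) r * hInt q r) (by
      filter_upwards [Ioo_mem_nhdsGT hr] with t ht
      have h5 := hm ⟨ht.1, ht.2.le⟩ ⟨hr, le_rfl⟩ ht.2.le
      simp only at h5
      nlinarith [sq_nonneg (hfun q t)])
    linarith
  refine ⟨a, ⟨hqpos, fun r hr => hq1.hasDerivAt hr, ?_, hq1.2.2.1, ?_, hq1.strictMonoOn, ?_, ?_, ?_,
    hpos, hD, h3, h4, hmonoh, hdh, hKpos, hKD, hKmono, hKlim, ?_, g1, ?_, g3, ha.1, hmono, c2⟩⟩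
  · exact hq1.1.continuousOn_deriv_of_isOpen isOpen_Ioi le_rfl
  · intro x hx
    rcases eq_or_lt_of_le (mem_Ici.1 hx) with rfl | hx
    · exact hq1.2.2.2
    · exact (hq1.hasDerivAt hx).continuousAt.continuousWithinAt
  · exact fun r hr => div_pos (hq1.2.1 r hr).2 (hqpos r hr)
  · exact hq2.antitoneOn
  · have h5 := intervalIntegral_tendsto_integral_Ioi (1:ℝ) hi tendsto_id
    have h6 : Tendsto (fun r => invTail q 1 - ∫ s in (1:ℝ)..r, 1 / q s) atTop
        (𝓝 (invTail q 1 - invTail q 1)) := tendsto_const_nhds.sub h5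
    rw [sub_self] at h6
    refine h6.congr' ?_
    filter_upwards [eventually_gt_atTop 0] with r hr using (invTail_eq hq1 hi hr).symm
  · have hsq : AntitoneOn (fun r => hfun q r ^ 2 / hInt q r) (Ioi 0) := by
      apply antitoneOn_of_hasDerivWithinAt_nonpos (convex_Ioi 0)
        (f' := fun t => (2 * hfun q t * deriv (hfun q) t * hInt q t - hfun q t ^ 2 * hfun q t)
          / hInt q t ^ 2)
      · intro x hx
        exact (((hD x hx).continuousAt.pow 2).div (hKD x hx).continuousAt
          (hKpos x hx).ne').continuousWithinAt
      · intro x hx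
        rw [interior_Ioi] at hx
        refine HasDerivAt.hasDerivWithinAt ?_
        refine (((hD x hx).pow 2).div (hKD x hx) (hKpos x hx).ne').congr_deriv ?_
        simp only [Pi.pow_apply]
        push_cast
        ring
      · intro x hx
        rw [interior_Ioi] at hx
        apply div_nonpos_of_nonpos_of_nonneg _ (sq_nonneg _)
        have := key x hx
        have h5 := hpos x hx
        nlinarith
    intro x hx y hy hxy
    have h5 := Real.sqrt_le_sqrt (hsq hx hy hxy)
    simp only at h5
    rwa [Real.sqrt_div (sq_nonneg _), Real.sqrt_div (sq_nonneg _), Real.sqrt_sq (hpos x hx).le,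
      Real.sqrt_sq (hpos y hy).le] at h5
  · exact fun r hr => (g2.1 ⟨r, hr, rfl⟩).trans c1

/-- The consequences of the hypotheses on the nonlinearity used in the comparison argument. -/
structure AdmissibleNonlinearity (c : EReal) (f : ℝ → ℝ) (b β C : ℝ) : Prop where
  odd : ∀ s, f (-s) = -f s
  b_pos : 0 < b
  b_lt : b < β
  β_lt : (β : EReal) < c
  continuousAt : ∀ s, InCC c s → ContinuousAt f s
  contDiffAt : ∀ s : ℝ, 0 < s → (s : EReal) < c → ContDiffAt ℝ 1 f s
  pos : ∀ s : ℝ, b < s → (s : EReal) < c → 0 < f s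
  nonpos : ∀ s ∈ Icc 0 b, f s ≤ 0
  F_hasDerivAt : ∀ s, InCC c s → HasDerivAt (Fint f) (f s) s
  F_even : ∀ s, Fint f (-s) = Fint f s
  F_pos : ∀ s : ℝ, β < s → (s : EReal) < c → 0 < Fint f s
  F_nonpos : ∀ s, |s| ≤ β → Fint f s ≤ 0
  le_deriv_ratio : ∀ s : ℝ, β < s → (s : EReal) < c → C ≤ deriv (fun t => Fint f t / f t) s

lemma InCC.neg {c : EReal} {s : ℝ} (h : InCC c s) : InCC c (-s) := by
  refine ⟨?_, ?_⟩
  · rw [EReal.coe_neg]; exact EReal.neg_lt_neg_iff.2 h.2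
  · rw [EReal.coe_neg, EReal.neg_lt_comm]; exact h.1

lemma inCC_of_pos {c : EReal} {s : ℝ} (hs : 0 ≤ s) (h : (s : EReal) < c) : InCC c s := by
  refine ⟨?_, h⟩
  rw [EReal.neg_lt_comm, ← EReal.coe_neg]
  exact lt_of_le_of_lt (EReal.coe_le_coe_iff.2 (by linarith)) h

lemma isOpen_inCC (c : EReal) : IsOpen {s : ℝ | InCC c s} :=
  (isOpen_lt continuous_const continuous_coe_real_ereal).inter
    (isOpen_lt continuous_coe_real_ereal continuous_const)

lemma InCC.mem_Icc {c : EReal} {s t r : ℝ} (hs : InCC c s) (ht : InCC c t) (hr : r ∈ Icc s t) :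
    InCC c r :=
  ⟨lt_of_lt_of_le hs.1 (EReal.coe_le_coe_iff.2 hr.1),
    lt_of_le_of_lt (EReal.coe_le_coe_iff.2 hr.2) ht.2⟩

lemma InCC.of_abs_le {c : EReal} {s t : ℝ} (hs : InCC c s) (ht : |t| ≤ |s|) : InCC c t := by
  have h : InCC c |s| := by
    rcases abs_choice s with h | h <;> rw [h]
    exacts [hs, hs.neg]
  exact h.neg.mem_Icc h (abs_le.1 ht)

lemma admissibleNonlinearity {c : EReal} {f : ℝ → ℝ} {b β C : ℝ} (hf1 : CondF1 c f b β)
    (hf2 : CondF2 c f) (hf7 : CondF7 c f β C) (h0 : ContinuousAt f 0) :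
    AdmissibleNonlinearity c f b β C := by
  obtain ⟨hodd, hf0, hb, hbβ, hβc, hpos, hnonpos, ⟨s₀, hs₀, hs₀'⟩, hFβ⟩ := hf1
  have hDopen : IsOpen {s : ℝ | 0 < s ∧ (s : EReal) < c} :=
    isOpen_Ioi.inter (isOpen_lt continuous_coe_real_ereal continuous_const)
  have hcd : ∀ s : ℝ, 0 < s → (s : EReal) < c → ContDiffAt ℝ 1 f s := fun s hs hsc =>
    hf2.1.contDiffAt (hDopen.mem_nhds ⟨hs, hsc⟩)
  have hcpos : ∀ s : ℝ, 0 < s → (s : EReal) < c → ContinuousAt f s := fun s hs hsc =>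
    (hcd s hs hsc).continuousAt
  have hcont : ∀ s, InCC c s → ContinuousAt f s := by
    intro s hs
    rcases lt_trichotomy s 0 with h | h | h
    · have h1 : ContinuousAt (fun t => -f (-t)) s :=
        (ContinuousAt.comp (f := fun t : ℝ => -t) (g := f) (hcpos (-s) (by linarith) hs.neg.2)
          continuousAt_neg).neg
      simpa [hodd] using h1
    · rw [h]; exact h0
    · exact hcpos s h hs.2
  have hzero : InCC c 0 := inCC_of_pos le_rfl
    (lt_of_le_of_lt (EReal.coe_le_coe_iff.2 (hb.trans hbβ).le) hβc)
  have hcontOn : ContinuousOn f {s | InCC c s} := fun s hs => (hcont s hs).continuousWithinAt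
  have hInteg : ∀ s t, InCC c s → InCC c t → IntervalIntegrable f volume s t := by
    intro s t hs ht
    apply (hcontOn.mono _).intervalIntegrable
    intro x hx
    rcases le_total s t with h | h
    · rw [uIcc_of_le h] at hx; exact hs.mem_Icc ht hx
    · rw [uIcc_of_ge h] at hx; exact ht.mem_Icc hs hx
  have hFD : ∀ s, InCC c s → HasDerivAt (Fint f) (f s) s := fun s hs =>
    intervalIntegral.integral_hasDerivAt_right (hInteg 0 s hzero hs)
      (hcontOn.stronglyMeasurableAtFilter (isOpen_inCC c) s hs) (hcont s hs)
  have hFeven : ∀ s, Fint f (-s) = Fint f s := by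
    intro s
    unfold Fint
    have h1 := intervalIntegral.integral_comp_neg (a := 0) (b := s) f
    rw [neg_zero] at h1
    simp only [hodd, intervalIntegral.integral_neg] at h1
    rw [intervalIntegral.integral_symm, ← h1, neg_neg]
  have hin : ∀ s : ℝ, 0 ≤ s → (s : EReal) < c → InCC c s := fun s h h' => inCC_of_pos h h'
  have hlt : ∀ s t : ℝ, s ≤ t → (t : EReal) < c → (s : EReal) < c := fun s t h h' =>
    lt_of_le_of_lt (EReal.coe_le_coe_iff.2 h) h'
  have hmono : ∀ t : ℝ, b < t → (t : EReal) < c → StrictMonoOn (Fint f) (Icc b t) := by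
    intro t hbt htc
    apply strictMonoOn_of_deriv_pos (convex_Icc b t)
    · exact fun x hx => (hFD x (hin x (hb.le.trans hx.1)
        (hlt x t hx.2 htc))).continuousAt.continuousWithinAt
    · intro x hx
      rw [interior_Icc] at hx
      have hxc := hlt x t hx.2.le htc
      rw [(hFD x (hin x (hb.le.trans hx.1.le) hxc)).deriv]
      exact hpos x hx.1 hxc
  refine ⟨hodd, hb, hbβ, hβc, hcont, hcd, hpos, hnonpos, hFD, hFeven, ?_, ?_, hf7⟩
  · intro s hs hsc
    rw [← hFβ]
    exact hmono s (hbβ.trans hs) hsc ⟨hbβ.le, hs.le⟩ ⟨(hbβ.trans hs).le, le_rfl⟩ hs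
  · intro s hs
    wlog h : 0 ≤ s generalizing s
    · rw [← hFeven]
      exact this (-s) (by rwa [abs_neg]) (by linarith)
    rw [abs_of_nonneg h] at hs
    rcases le_or_gt s b with h1 | h1
    · have := intervalIntegral.integral_mono_on h (hInteg 0 s hzero (hin s h (hlt s β hs hβc)))
        (intervalIntegrable_const (c := (0 : ℝ)))
        (fun x hx => hnonpos x ⟨hx.1, hx.2.trans h1⟩)
      simpa [Fint] using this
    · rw [← hFβ]
      exact (hmono β hbβ hβc).monotoneOn ⟨h1.le, hs⟩ ⟨hbβ.le, le_rfl⟩ hs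

namespace AdmissibleNonlinearity

variable {c : EReal} {f : ℝ → ℝ} {b β C : ℝ}

lemma β_pos (hf : AdmissibleNonlinearity c f b β C) : 0 < β := hf.b_pos.trans hf.b_lt

lemma zero_mem (hf : AdmissibleNonlinearity c f b β C) : InCC c 0 :=
  inCC_of_pos le_rfl (lt_of_le_of_lt (EReal.coe_le_coe_iff.2 hf.β_pos.le) hf.β_lt)

lemma F_β (hf : AdmissibleNonlinearity c f b β C) : Fint f β = 0 := by
  apply le_antisymm
  · exact hf.F_nonpos β (abs_of_pos hf.β_pos).le
  · have hβ := hf.β_lt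
    have hc : ContinuousAt (Fint f) β :=
      (hf.F_hasDerivAt β (inCC_of_pos hf.β_pos.le hf.β_lt)).continuousAt
    refine ge_of_tendsto (hc.tendsto.mono_left (nhdsWithin_le_nhds (s := Ioi β))) ?_
    have : ∀ᶠ s : ℝ in 𝓝[>] β, (s : EReal) < c :=
      nhdsWithin_le_nhds ((isOpen_lt continuous_coe_real_ereal continuous_const).mem_nhds hβ)
    filter_upwards [this, self_mem_nhdsWithin] with s hs hs'
    exact (hf.F_pos s hs' hs).le

lemma lt_abs_of_F_pos (hf : AdmissibleNonlinearity c f b β C) {s : ℝ} (h : 0 < Fint f s) :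
    β < |s| := by
  by_contra! h'
  exact absurd (hf.F_nonpos s h') (not_le.2 h)

lemma F_abs (hf : AdmissibleNonlinearity c f b β C) (s : ℝ) : Fint f |s| = Fint f s := by
  rcases abs_choice s with h | h <;> rw [h]
  exact hf.F_even s

lemma F_pos' (hf : AdmissibleNonlinearity c f b β C) {s : ℝ} (hs : InCC c s) (h : β < |s|) :
    0 < Fint f s := by
  rw [← hf.F_abs]
  refine hf.F_pos _ h ?_
  exact (hs.of_abs_le (t := |s|) (abs_abs s).le).2

lemma f_ne (hf : AdmissibleNonlinearity c f b β C) {s : ℝ} (hs : InCC c s) (h : b < |s|) :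
    f s ≠ 0 := by
  have h1 : InCC c |s| := hs.of_abs_le (abs_abs s).le
  have := hf.pos _ h h1.2
  rcases abs_choice s with h2 | h2 <;> rw [h2] at this
  · exact this.ne'
  · rw [hf.odd] at this
    intro h3
    linarith

lemma f_neg (hf : AdmissibleNonlinearity c f b β C) {s : ℝ} (hs : InCC c s) (h : s < -b) :
    f s < 0 := by
  have := hf.pos (-s) (by linarith) hs.neg.2
  rw [hf.odd] at this
  linarith

lemma ratio_odd (hf : AdmissibleNonlinearity c f b β C) (s : ℝ) :
    Fint f (-s) / f (-s) = -(Fint f s / f s) := by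
  rw [hf.F_even, hf.odd, div_neg]

lemma differentiableAt (hf : AdmissibleNonlinearity c f b β C) {s : ℝ} (hs : InCC c s)
    (h : s ≠ 0) : DifferentiableAt ℝ f s := by
  rcases lt_or_gt_of_ne h with h | h
  · have h1 : DifferentiableAt ℝ (fun t => -f (-t)) s :=
      (DifferentiableAt.comp (f := fun t : ℝ => -t) (g := f) s
        ((hf.contDiffAt (-s) (by linarith) hs.neg.2).differentiableAt (by norm_num))
        differentiableAt_id.neg).neg
    simpa [hf.odd] using h1
  · exact (hf.contDiffAt s h hs.2).differentiableAt (by norm_num)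

lemma ratio_hasDerivAt (hf : AdmissibleNonlinearity c f b β C) {s : ℝ} (hs : InCC c s)
    (h : b < |s|) :
    HasDerivAt (fun t => Fint f t / f t) (deriv (fun t => Fint f t / f t) s) s := by
  have h0 : s ≠ 0 := by
    rintro rfl
    rw [abs_zero] at h
    linarith [hf.b_pos]
  exact ((hf.F_hasDerivAt s hs).differentiableAt.div (hf.differentiableAt hs h0)
    (hf.f_ne hs h)).hasDerivAt

lemma le_deriv_ratio' (hf : AdmissibleNonlinearity c f b β C) {s : ℝ} (hs : InCC c s)
    (h : β < |s|) : C ≤ deriv (fun t => Fint f t / f t) s := by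
  have h1 : InCC c |s| := hs.of_abs_le (abs_abs s).le
  have h2 := hf.le_deriv_ratio _ h h1.2
  rcases abs_choice s with h3 | h3 <;> rw [h3] at h2
  · exact h2
  · have h4 : (fun t => Fint f t / f t) = fun t => -(fun t => Fint f t / f t) (-t) := by
      funext t
      simp only [hf.ratio_odd, neg_neg]
    have h5 : deriv (fun t => Fint f t / f t) s = deriv (fun t => Fint f t / f t) (-s) := by
      conv_lhs => rw [h4]
      rw [deriv.fun_neg]
      have h6 := deriv_comp_neg (f := fun t => Fint f t / f t) s
      rw [h6, neg_neg]
    rwa [h5]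

end AdmissibleNonlinearity

/-- A solution of (E) tending to `0` at infinity, written as a first order system for
`(u, v) = (u, u')`. -/
structure BoundOrbit (c : EReal) (f q u v : ℝ → ℝ) : Prop where
  mem : ∀ r, 0 ≤ r → InCC c (u r)
  hasDerivAt : ∀ r, 0 < r → HasDerivAt u (v r) r
  hasDerivAt_deriv : ∀ r, 0 < r → HasDerivAt v (-(damping q r * v r) - f (u r)) r
  continuousOn : ContinuousOn u (Ici 0)
  continuousOn_deriv : ContinuousOn v (Ici 0)
  deriv_zero : v 0 = 0
  tendsto : Tendsto u atTop (𝓝 0)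

/-- The energy `u'²/2 + F(u)`. -/
def energy (f u v : ℝ → ℝ) (r : ℝ) : ℝ := v r ^ 2 / 2 + Fint f (u r)

lemma boundOrbit_of_isSolutionE {c : EReal} {f q u : ℝ → ℝ} {a b β C : ℝ}
    (hf : AdmissibleNonlinearity c f b β C) (hq : AdmissibleWeight q a C)
    (hu : IsSolutionE c f q u) (hlim : Tendsto u atTop (𝓝 0)) :
    BoundOrbit c f q u (deriv u) := by
  have hdiff : ∀ r, 0 < r → DifferentiableAt ℝ u r := fun r hr =>
    (hu.c1.contDiffAt (Ici_mem_nhds hr)).differentiableAt (by norm_num)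
  have hu1 : ∀ r, 0 < r → HasDerivAt u (deriv u r) r := fun r hr => (hdiff r hr).hasDerivAt
  have hv1 : ∀ r, 0 < r → HasDerivAt (deriv u) (-(damping q r * deriv u r) - f (u r)) r := by
    intro r hr
    refine (hu.diff2 r hr).hasDerivAt.congr_deriv ?_
    have := hu.ode r hr
    unfold damping
    linarith
  have hcu : ContinuousOn u (Ici 0) := hu.c1.continuousOn
  set w := derivWithin u (Ici 0) with hw
  have hcw : ContinuousOn w (Ici 0) :=
    hu.c1.continuousOn_derivWithin (uniqueDiffOn_Ici 0) le_rfl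
  have hwv : ∀ r, 0 < r → w r = deriv u r := fun r hr =>
    derivWithin_of_mem_nhds (Ici_mem_nhds hr)
  have hw0 : w 0 = 0 := by
    have hfc : ContinuousOn (fun r => f (u r)) (Icc 0 1) := by
      intro r hr
      exact (hf.continuousAt _ (hu.mem r hr.1)).comp_continuousWithinAt
        ((hcu r hr.1).mono Icc_subset_Ici_self)
    obtain ⟨B, hB⟩ := isCompact_Icc.exists_bound_of_continuousOn hfc
    have hle : ∀ r ∈ Ioc (0:ℝ) 1, |w r| ≤ B * r := by
      intro r hr
      have h1 : ∀ x ∈ Ico 0 r, x ≠ 0 →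
          HasDerivAt (fun x => q x * w x) (-(q x * f (u x))) x := by
        intro x hx hx0
        have hx1 : 0 < x := lt_of_le_of_ne hx.1 (Ne.symm hx0)
        have h2 : HasDerivAt (fun x => q x * deriv u x) (-(q x * f (u x))) x := by
          refine ((hq.hasDerivAt x hx1).mul (hv1 x hx1)).congr_deriv ?_
          have := (hq.pos x hx1).ne'
          unfold damping
          field_simp
          ring
        refine h2.congr_of_eventuallyEq ?_
        filter_upwards [Ioi_mem_nhds hx1] with y hy
        rw [hwv y hy]
      have hqw : ContinuousOn (fun x => q x * w x) (Icc 0 r) :=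
        (hq.continuousOn.mul hcw).mono Icc_subset_Ici_self
      obtain ⟨x, hx, hx2⟩ := exists_hasDerivAt_eq_slope (fun x => q x * w x)
        (fun x => -(q x * f (u x))) hr.1 hqw
        (fun x hx => h1 x ⟨hx.1.le, hx.2⟩ hx.1.ne')
      simp only [hq.zero, zero_mul, sub_zero] at hx2
      have hqr := hq.pos r hr.1
      have hqx := hq.pos x hx.1
      have hqxr : q x ≤ q r := hq.strictMonoOn.monotoneOn (mem_Ici.2 hx.1.le)
        (mem_Ici.2 hr.1.le) hx.2.le
      have h3 := hB x ⟨hx.1.le, hx.2.le.trans hr.2⟩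
      rw [Real.norm_eq_abs] at h3
      rw [eq_div_iff hr.1.ne'] at hx2
      have h4 : q r * |w r| = q x * |f (u x)| * r := by
        rw [← abs_of_pos hqr, ← abs_mul, ← hx2, abs_mul, abs_neg, abs_mul, abs_of_pos hqx,
          abs_of_pos hr.1]
      have h5 : q r * |w r| ≤ q r * (B * r) := by
        rw [h4, ← mul_assoc]
        exact mul_le_mul_of_nonneg_right
          (mul_le_mul hqxr h3 (abs_nonneg _) hqr.le) hr.1.le
      exact le_of_mul_le_mul_left h5 hqr
    have ht : Tendsto w (𝓝[>] 0) (𝓝 (w 0)) :=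
      (hcw 0 self_mem_Ici).tendsto.mono_left (nhdsWithin_mono _ Ioi_subset_Ici_self)
    have ht2 : Tendsto w (𝓝[>] 0) (𝓝 0) := by
      refine squeeze_zero_norm' (a := fun r => B * r) ?_ ?_
      · filter_upwards [Ioc_mem_nhdsGT (one_pos : (0:ℝ) < 1)] with r hr
        exact hle r hr
      · have : Tendsto (fun r : ℝ => B * r) (𝓝 0) (𝓝 (B * 0)) := (continuous_const_mul B).tendsto 0
        rw [mul_zero] at this
        exact this.mono_left nhdsWithin_le_nhds
    exact tendsto_nhds_unique ht ht2
  refine ⟨hu.mem, hu1, hv1, hcu, ?_, hu.d0, hlim⟩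
  refine hcw.congr fun r hr => ?_
  rcases eq_or_lt_of_le (mem_Ici.1 hr) with rfl | h
  · rw [hw0, hu.d0]
  · rw [hwv r h]

namespace BoundOrbit

variable {c : EReal} {f q u v : ℝ → ℝ} {a b β C R : ℝ}

lemma neg (hf : AdmissibleNonlinearity c f b β C) (ho : BoundOrbit c f q u v) :
    BoundOrbit c f q (-u) (-v) where
  mem r hr := (ho.mem r hr).neg
  hasDerivAt r hr := (ho.hasDerivAt r hr).neg
  hasDerivAt_deriv r hr := by
    refine (ho.hasDerivAt_deriv r hr).neg.congr_deriv ?_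
    simp only [Pi.neg_apply, hf.odd]
    ring
  continuousOn := ho.continuousOn.neg
  continuousOn_deriv := ho.continuousOn_deriv.neg
  deriv_zero := by simp [ho.deriv_zero]
  tendsto := by
    have h := ho.tendsto.neg
    rwa [neg_zero] at h

lemma F_hasDerivAt (hf : AdmissibleNonlinearity c f b β C) (ho : BoundOrbit c f q u v)
    {r : ℝ} (hr : 0 < r) : HasDerivAt (fun r => Fint f (u r)) (f (u r) * v r) r :=
  (hf.F_hasDerivAt _ (ho.mem r hr.le)).comp r (ho.hasDerivAt r hr)

lemma energy_hasDerivAt (hf : AdmissibleNonlinearity c f b β C) (ho : BoundOrbit c f q u v)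
    {r : ℝ} (hr : 0 < r) : HasDerivAt (energy f u v) (-(damping q r * v r ^ 2)) r := by
  refine ((((ho.hasDerivAt_deriv r hr).pow 2).div_const 2).add
    (ho.F_hasDerivAt hf hr)).congr_deriv ?_
  push_cast
  ring

lemma F_continuousOn (hf : AdmissibleNonlinearity c f b β C) (ho : BoundOrbit c f q u v) :
    ContinuousOn (fun r => Fint f (u r)) (Ici 0) := fun r hr =>
  (hf.F_hasDerivAt _ (ho.mem r hr)).continuousAt.comp_continuousWithinAt (ho.continuousOn r hr)

lemma energy_continuousOn (hf : AdmissibleNonlinearity c f b β C)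
    (ho : BoundOrbit c f q u v) : ContinuousOn (energy f u v) (Ici 0) :=
  ((ho.continuousOn_deriv.pow 2).div_const 2).add (ho.F_continuousOn hf)

lemma energy_antitoneOn (hf : AdmissibleNonlinearity c f b β C) (hq : AdmissibleWeight q a C)
    (ho : BoundOrbit c f q u v) : AntitoneOn (energy f u v) (Ici 0) := by
  apply antitoneOn_of_deriv_nonpos (convex_Ici 0) (ho.energy_continuousOn hf)
  · intro x hx
    rw [interior_Ici] at hx
    exact (ho.energy_hasDerivAt hf hx).differentiableAt.differentiableWithinAt
  · intro x hx
    rw [interior_Ici] at hx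
    rw [(ho.energy_hasDerivAt hf hx).deriv]
    have := (hq.damping_pos x hx).le
    have : 0 ≤ damping q x * v x ^ 2 := by positivity
    linarith

lemma F_tendsto (hf : AdmissibleNonlinearity c f b β C) (ho : BoundOrbit c f q u v) :
    Tendsto (fun r => Fint f (u r)) atTop (𝓝 0) := by
  have h := (hf.F_hasDerivAt 0 hf.zero_mem).continuousAt.tendsto.comp ho.tendsto
  simpa [Fint, Function.comp_def] using h

lemma energy_nonneg (hf : AdmissibleNonlinearity c f b β C) (hq : AdmissibleWeight q a C)
    (ho : BoundOrbit c f q u v) {r : ℝ} (hr : 0 ≤ r) : 0 ≤ energy f u v r := by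
  refine le_of_tendsto (ho.F_tendsto hf) ?_
  filter_upwards [eventually_ge_atTop r] with s hs
  have h1 := ho.energy_antitoneOn hf hq (mem_Ici.2 hr) (mem_Ici.2 (hr.trans hs)) hs
  have h2 : Fint f (u s) ≤ energy f u v s := by
    unfold energy
    nlinarith [sq_nonneg (v s)]
  linarith

/-- A bound orbit with vanishing energy is at rest from then on. -/
lemma eq_zero_of_energy_eq_zero (hf : AdmissibleNonlinearity c f b β C)
    (hq : AdmissibleWeight q a C) (ho : BoundOrbit c f q u v) {R : ℝ} (hR : 0 ≤ R)
    (hE : energy f u v R = 0) {r : ℝ} (hr : R ≤ r) : u r = 0 ∧ v r = 0 := by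
  have hE0 : ∀ s, R ≤ s → energy f u v s = 0 := fun s hs => le_antisymm
    (hE ▸ ho.energy_antitoneOn hf hq (mem_Ici.2 hR) (mem_Ici.2 (hR.trans hs)) hs)
    (ho.energy_nonneg hf hq (hR.trans hs))
  have hv : ∀ s, R < s → v s = 0 := by
    intro s hs
    have hs0 := hR.trans_lt hs
    have h1 : HasDerivAt (energy f u v) 0 s :=
      (hasDerivAt_const s (0:ℝ)).congr_of_eventuallyEq (by
        filter_upwards [Ioi_mem_nhds hs] with t ht using hE0 t (le_of_lt ht))
    have h2 := h1.unique (ho.energy_hasDerivAt hf hs0)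
    have h3 := hq.damping_pos s hs0
    have h4 : damping q s * v s ^ 2 = 0 := by linarith
    simpa [h3.ne'] using h4
  have hconst : ∀ s, R ≤ s → u s = u R := by
    intro s hs
    rcases eq_or_lt_of_le hs with rfl | hs'
    · rfl
    obtain ⟨x, hx, hx2⟩ := exists_hasDerivAt_eq_slope u v hs'
      (ho.continuousOn.mono fun y hy => hR.trans hy.1)
      (fun x hx => ho.hasDerivAt x (hR.trans_lt hx.1))
    rw [hv x hx.1, eq_comm, div_eq_zero_iff] at hx2
    rcases hx2 with h | h <;> linarith
  have hu0 : u R = 0 := by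
    refine tendsto_nhds_unique (tendsto_const_nhds.congr' ?_) ho.tendsto
    filter_upwards [eventually_ge_atTop R] with s hs using (hconst s hs).symm
  have hur : u r = 0 := (hconst r hr).trans hu0
  refine ⟨hur, ?_⟩
  have h := hE0 r hr
  simp only [energy, hur, Fint, intervalIntegral.integral_same, add_zero] at h
  have : v r ^ 2 = 0 := by linarith
  simpa using this

lemma lt_abs_of_deriv_eq_zero (hf : AdmissibleNonlinearity c f b β C)
    (hq : AdmissibleWeight q a C) (ho : BoundOrbit c f q u v) {R : ℝ} (hR : 0 ≤ R)
    (hv : v R = 0) (hu : u R ≠ 0) : β < |u R| := by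
  apply hf.lt_abs_of_F_pos
  have h1 := ho.energy_nonneg hf hq hR
  have h2 : energy f u v R ≠ 0 := fun h => hu (ho.eq_zero_of_energy_eq_zero hf hq hR h le_rfl).1
  have h3 : energy f u v R = Fint f (u R) := by simp [energy, hv]
  rw [h3] at h1 h2
  exact lt_of_le_of_ne h1 (Ne.symm h2)

lemma flux_hasDerivAt (hq : AdmissibleWeight q a C) (ho : BoundOrbit c f q u v) {r : ℝ}
    (hr : 0 < r) : HasDerivAt (fun x => q x * v x) (-(q r * f (u r))) r := by
  refine ((hq.hasDerivAt r hr).mul (ho.hasDerivAt_deriv r hr)).congr_deriv ?_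
  have := (hq.pos r hr).ne'
  unfold damping
  field_simp
  ring

lemma flux_continuousOn (hq : AdmissibleWeight q a C) (ho : BoundOrbit c f q u v) :
    ContinuousOn (fun x => q x * v x) (Ici 0) := hq.continuousOn.mul ho.continuousOn_deriv

/-- If `u > b` between a critical point and `y`, then `u' < 0` at `y`. -/
lemma deriv_neg_of_lt (hf : AdmissibleNonlinearity c f b β C) (hq : AdmissibleWeight q a C)
    (ho : BoundOrbit c f q u v) {R y : ℝ} (hR : 0 ≤ R) (hRy : R < y) (hv : v R = 0)
    (hu : ∀ t ∈ Ioo R y, b < u t) : v y < 0 := by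
  have h : StrictAntiOn (fun x => q x * v x) (Icc R y) := by
    apply strictAntiOn_of_deriv_neg (convex_Icc R y)
    · exact (ho.flux_continuousOn hq).mono fun x hx => hR.trans hx.1
    · intro x hx
      rw [interior_Icc] at hx
      have hx0 := hR.trans_lt hx.1
      rw [(ho.flux_hasDerivAt hq hx0).deriv]
      have := mul_pos (hq.pos x hx0) (hf.pos _ (hu x hx) (ho.mem x hx0.le).2)
      linarith
  have h1 := h ⟨le_rfl, hRy.le⟩ ⟨hRy.le, le_rfl⟩ hRy
  simp only [hv, mul_zero] at h1
  by_contra! h2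
  exact absurd h1 (not_lt.2 (mul_nonneg (hq.pos y (hR.trans_lt hRy)).le h2))

end BoundOrbit

/-- The set of radii `r > R` up to which `v` has been negative. -/
def descent (v : ℝ → ℝ) (R : ℝ) : Set ℝ := {r | R < r ∧ ∀ t ∈ Ioc R r, v t < 0}

/-- The descent from `R` ends at a negative minimum, attained at `R'`. -/
def EndsAt (u v : ℝ → ℝ) (β R R' : ℝ) : Prop :=
  R < R' ∧ v R' = 0 ∧ u R' < -β ∧ ∀ t ∈ Ioo R R', v t < 0

/-- The descent from `R` is the final one: the solution decreases to `0` and stays there. -/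
def IsTerminal (q u v : ℝ → ℝ) (R : ℝ) : Prop :=
  (∀ t, R ≤ t → 0 ≤ u t) ∧ (∀ s ∈ Ioo 0 (u R), ∃ r ∈ descent v R, u r = s) ∧
    ∀ ε > 0, ∀ δ > 0, ∃ r ∈ descent v R, 0 < u r ∧ u r < δ ∧ hfun q r * (-v r) < ε

lemma descent_of_lt {v : ℝ → ℝ} {R r s : ℝ} (hr : r ∈ descent v R) (hs : R < s) (hsr : s ≤ r) :
    s ∈ descent v R := ⟨hs, fun t ht => hr.2 t ⟨ht.1, ht.2.trans hsr⟩⟩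

namespace BoundOrbit

variable {c : EReal} {f q u v : ℝ → ℝ} {a b β C R : ℝ}

lemma exists_gt_mem_descent (ho : BoundOrbit c f q u v) (hR : 0 ≤ R) {r : ℝ}
    (hr : r ∈ descent v R) {x : ℝ} (hx : r < x) : ∃ y ∈ descent v R, r < y ∧ y < x := by
  have h0 : 0 < r := hR.trans_lt hr.1
  have hc : ContinuousAt v r := (ho.hasDerivAt_deriv r h0).continuousAt
  have h1 : ∀ᶠ t in 𝓝 r, v t < 0 := hc.eventually_lt continuousAt_const (hr.2 r ⟨hr.1, le_rfl⟩)
  obtain ⟨ε, hε, hε2⟩ := Metric.eventually_nhds_iff.1 h1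
  have hm : 0 < min (ε / 2) ((x - r) / 2) := lt_min (by linarith) (by linarith)
  refine ⟨r + min (ε / 2) ((x - r) / 2), ⟨by linarith [hr.1], fun t ht => ?_⟩, by linarith, ?_⟩
  · rcases le_or_gt t r with h | h
    · exact hr.2 t ⟨ht.1, h⟩
    · apply hε2
      rw [Real.dist_eq, abs_of_pos (by linarith)]
      linarith [ht.2, min_le_left (ε / 2) ((x - r) / 2)]
  · linarith [min_le_right (ε / 2) ((x - r) / 2)]

lemma strictAntiOn_descent (ho : BoundOrbit c f q u v) (hR : 0 ≤ R) {r : ℝ}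
    (hr : r ∈ descent v R) : StrictAntiOn u (Icc R r) := by
  apply strictAntiOn_of_deriv_neg (convex_Icc R r)
  · exact ho.continuousOn.mono fun x hx => hR.trans hx.1
  · intro x hx
    rw [interior_Icc] at hx
    rw [(ho.hasDerivAt x (hR.trans_lt hx.1)).deriv]
    exact hr.2 x ⟨hx.1, hx.2.le⟩

lemma lt_of_mem_descent (ho : BoundOrbit c f q u v) (hR : 0 ≤ R) {r s : ℝ}
    (hs : s ∈ descent v R) (hr : R ≤ r) (h : r < s) : u s < u r :=
  ho.strictAntiOn_descent hR hs ⟨hr, h.le⟩ ⟨hs.1.le, le_rfl⟩ h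

lemma eventually_mem_descent (hf : AdmissibleNonlinearity c f b β C)
    (hq : AdmissibleWeight q a C) (ho : BoundOrbit c f q u v) (hR : 0 ≤ R) (hv : v R = 0)
    (hu : β < u R) : ∀ᶠ r in 𝓝[>] R, r ∈ descent v R := by
  have h1 : ∀ᶠ t in 𝓝[≥] R, b < u t :=
    ((ho.continuousOn R hR).mono (Ici_subset_Ici.2 hR)).tendsto.eventually
      (lt_mem_nhds (hf.b_lt.trans hu))
  obtain ⟨w, hw, hw2⟩ := (mem_nhdsGE_iff_exists_Ico_subset).1 h1
  filter_upwards [Ioo_mem_nhdsGT (mem_Ioi.1 hw)] with r hr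
  refine ⟨hr.1, fun t ht => ?_⟩
  exact ho.deriv_neg_of_lt hf hq hR ht.1 hv fun s hs =>
    hw2 ⟨hs.1.le, hs.2.trans_le (ht.2.trans hr.2.le)⟩

lemma endsAt_or_isTerminal (hf : AdmissibleNonlinearity c f b β C)
    (hq : AdmissibleWeight q a C) (ho : BoundOrbit c f q u v) (hR : 0 ≤ R) (hv : v R = 0)
    (hu : β < u R) : (∃ R', EndsAt u v β R R') ∨ IsTerminal q u v R := by
  have huR : 0 < u R := hf.β_pos.trans hu
  by_cases hN : ∀ t, R < t → v t < 0
  · right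
    have hD : ∀ r, R < r → r ∈ descent v R := fun r hr => ⟨hr, fun t ht => hN t ht.1⟩
    have hanti : ∀ x y, R ≤ x → x < y → u y < u x := fun x y hx hxy =>
      ho.lt_of_mem_descent hR (hD y (hx.trans_lt hxy)) hx hxy
    have hpos : ∀ t, R ≤ t → 0 < u t := by
      intro t ht
      have h1 : 0 ≤ u (t + 1) := by
        refine le_of_tendsto ho.tendsto ?_
        filter_upwards [eventually_gt_atTop (t + 1)] with s hs
        exact (hanti (t + 1) s (by linarith) hs).le
      exact h1.trans_lt (hanti t (t + 1) ht (by linarith))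
    refine ⟨fun t ht => (hpos t ht).le, ?_, ?_⟩
    · intro s hs
      obtain ⟨T, hT⟩ := ((ho.tendsto.eventually (gt_mem_nhds hs.1)).and
        (eventually_gt_atTop R)).exists
      obtain ⟨r, hr, hr2⟩ := intermediate_value_Icc' hT.2.le
        (ho.continuousOn.mono fun x hx => hR.trans hx.1) (⟨hT.1.le, hs.2.le⟩ : s ∈ Icc (u T) (u R))
      refine ⟨r, hD r (lt_of_le_of_ne hr.1 ?_), hr2⟩
      rintro rfl
      exact hs.2.ne hr2.symm
    · intro ε hε δ hδ
      obtain ⟨T, hT⟩ := eventually_atTop.1 (ho.tendsto.eventually (gt_mem_nhds hf.b_pos))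
      set T' := max T (R + 1) with hT'
      have hT'R : R < T' := by linarith [le_max_right T (R + 1)]
      have hmono : MonotoneOn (fun x => q x * v x) (Ici T') := by
        apply monotoneOn_of_deriv_nonneg (convex_Ici T')
        · exact (ho.flux_continuousOn hq).mono (Ici_subset_Ici.2 (hR.trans hT'R.le))
        · intro x hx
          rw [interior_Ici] at hx
          exact (ho.flux_hasDerivAt hq
            (hR.trans_lt (hT'R.trans hx))).differentiableAt.differentiableWithinAt
        · intro x hx
          rw [interior_Ici] at hx
          have hx0 : R < x := hT'R.trans hx
          rw [(ho.flux_hasDerivAt hq (hR.trans_lt hx0)).deriv]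
          have h1 := hf.nonpos (u x) ⟨(hpos x hx0.le).le,
            (hT x ((le_max_left _ _).trans (le_of_lt hx))).le⟩
          have h2 := hq.pos x (hR.trans_lt hx0)
          nlinarith
      have hlim : Tendsto (fun x => invTail q x * (-(q T' * v T'))) atTop (𝓝 0) := by
        simpa using hq.invTail_tendsto.mul_const (-(q T' * v T'))
      obtain ⟨r, ⟨h1, h2⟩, h3⟩ := (((hlim.eventually (gt_mem_nhds hε)).and
        (ho.tendsto.eventually (gt_mem_nhds hδ))).and (eventually_gt_atTop T')).exists
      have hrR : R < r := hT'R.trans h3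
      refine ⟨r, hD r hrR, hpos r hrR.le, h2, lt_of_le_of_lt ?_ h1⟩
      have hr0 := hR.trans_lt hrR
      have h4 : 0 < invTail q r := by
        have := hq.h_pos r hr0
        exact (mul_pos_iff_of_pos_left (hq.pos r hr0)).1 this
      have h5 := hmono (mem_Ici.2 le_rfl) (mem_Ici.2 h3.le) h3.le
      have h6 : hfun q r * (-v r) = invTail q r * (-(q r * v r)) := by
        unfold hfun invTail
        ring
      rw [h6]
      exact mul_le_mul_of_nonneg_left (neg_le_neg h5) h4.le
  · push Not at hN
    set S := {t | R < t ∧ 0 ≤ v t} with hS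
    have hSne : S.Nonempty := hN
    have hSbdd : BddBelow S := ⟨R, fun t ht => ht.1.le⟩
    set R' := sInf S with hR'
    obtain ⟨w, hw⟩ := (ho.eventually_mem_descent hf hq hR hv hu).exists
    have hwR' : w ≤ R' := le_csInf hSne fun t ht => by
      by_contra! h
      exact absurd (hw.2 t ⟨ht.1, h.le⟩) (not_lt.2 ht.2)
    have hRR' : R < R' := hw.1.trans_le hwR'
    have hneg : ∀ t ∈ Ioo R R', v t < 0 := by
      intro t ht
      by_contra! h
      exact absurd (csInf_le hSbdd (⟨ht.1, h⟩ : t ∈ S)) (not_le.2 ht.2)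
    have hR'0 : 0 < R' := hR.trans_lt hRR'
    have hcont : ContinuousAt v R' := (ho.hasDerivAt_deriv R' hR'0).continuousAt
    have hvR' : v R' = 0 := by
      apply le_antisymm
      · refine le_of_tendsto (hcont.tendsto.mono_left (nhdsWithin_le_nhds (s := Iio R'))) ?_
        filter_upwards [Ioo_mem_nhdsLT hRR'] with t ht using (hneg t ht).le
      · have h1 : R' ∈ closure S := csInf_mem_closure hSne hSbdd
        obtain ⟨x, hx, hx2⟩ := mem_closure_iff_seq_limit.1 h1
        exact ge_of_tendsto' (hcont.tendsto.comp hx2) fun n => (hx n).2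
    have hD : ∀ r ∈ Ioo R R', r ∈ descent v R := fun r hr =>
      ⟨hr.1, fun t ht => hneg t ⟨ht.1, ht.2.trans_lt hr.2⟩⟩
    have hanti : StrictAntiOn u (Icc R R') := by
      apply strictAntiOn_of_deriv_neg (convex_Icc R R')
      · exact ho.continuousOn.mono fun x hx => hR.trans hx.1
      · intro x hx
        rw [interior_Icc] at hx
        rw [(ho.hasDerivAt x (hR.trans_lt hx.1)).deriv]
        exact hneg x hx
    by_cases hE : u R' = 0
    · right
      have hEz : energy f u v R' = 0 := by simp [energy, hvR', hE, Fint]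
      have hpos : ∀ t, R ≤ t → t < R' → 0 < u t := fun t h1 h2 => by
        rw [← hE]
        exact hanti ⟨h1, h2.le⟩ ⟨hRR'.le, le_rfl⟩ h2
      refine ⟨fun t ht => ?_, ?_, ?_⟩
      · rcases lt_or_ge t R' with h | h
        · exact (hpos t ht h).le
        · exact (ho.eq_zero_of_energy_eq_zero hf hq hR'0.le hEz h).1.ge
      · intro s hs
        obtain ⟨r, hr, hr2⟩ := intermediate_value_Ioo' hRR'.le
          (ho.continuousOn.mono fun x hx => hR.trans hx.1)
          (⟨by rw [hE]; exact hs.1, hs.2⟩ : s ∈ Ioo (u R') (u R))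
        exact ⟨r, hD r hr, hr2⟩
      · intro ε hε δ hδ
        have h1 : Tendsto (fun r => hfun q r * (-v r)) (𝓝 R') (𝓝 0) := by
          have := (hq.h_hasDerivAt R' hR'0).continuousAt.tendsto.mul hcont.tendsto.neg
          rwa [hvR', neg_zero, mul_zero] at this
        have h2 : Tendsto u (𝓝 R') (𝓝 0) := by
          have := (ho.hasDerivAt R' hR'0).continuousAt.tendsto
          rwa [hE] at this
        have h3 : ∀ᶠ r in 𝓝[<] R', hfun q r * (-v r) < ε ∧ u r < δ ∧ r ∈ Ioo R R' :=
          (eventually_nhdsWithin_of_eventually_nhds (h1.eventually (gt_mem_nhds hε))).and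
            ((eventually_nhdsWithin_of_eventually_nhds (h2.eventually (gt_mem_nhds hδ))).and
              (Ioo_mem_nhdsLT hRR'))
        obtain ⟨r, h4, h5, h6⟩ := h3.exists
        exact ⟨r, hD r h6, hpos r h6.1.le h6.2, h5, h4⟩
    · left
      refine ⟨R', hRR', hvR', ?_, hneg⟩
      have h1 := ho.lt_abs_of_deriv_eq_zero hf hq hR'0.le hvR' hE
      rcases lt_abs.1 h1 with h | h
      · exfalso
        refine absurd (ho.deriv_neg_of_lt hf hq hR hRR' hv fun t ht => ?_) (not_lt.2 hvR'.ge)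
        exact (hf.b_lt.trans h).trans (hanti ⟨ht.1.le, ht.2.le⟩ ⟨hRR'.le, le_rfl⟩ ht.2)
      · linarith

end BoundOrbit

/-- A monotone piece of a solution parametrized by its value `s ∈ (l, M)`: `r s` is the radius and
`p s = -u'(r s) > 0`. -/
structure Branch (c : EReal) (f q : ℝ → ℝ) (l M : ℝ) (r p : ℝ → ℝ) : Prop where
  mem : ∀ s ∈ Ioo l M, InCC c s
  r_pos : ∀ s ∈ Ioo l M, 0 < r s
  p_pos : ∀ s ∈ Ioo l M, 0 < p s
  r_hasDerivAt : ∀ s ∈ Ioo l M, HasDerivAt r (-(1 / p s)) s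
  p_hasDerivAt : ∀ s ∈ Ioo l M, HasDerivAt p (damping q (r s) - f s / p s) s
  energy_pos : ∀ s ∈ Ioo l M, 0 < p s ^ 2 + 2 * Fint f s

lemma Branch.mono {c : EReal} {f q r p : ℝ → ℝ} {l M l' M' : ℝ} (h : Branch c f q l M r p)
    (hl : l ≤ l') (hM : M' ≤ M) : Branch c f q l' M' r p := by
  have hs : Ioo l' M' ⊆ Ioo l M := Ioo_subset_Ioo hl hM
  exact ⟨fun s h' => h.mem s (hs h'), fun s h' => h.r_pos s (hs h'), fun s h' => h.p_pos s (hs h'),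
    fun s h' => h.r_hasDerivAt s (hs h'), fun s h' => h.p_hasDerivAt s (hs h'),
    fun s h' => h.energy_pos s (hs h')⟩

/-- The radius in the descent from `R` at which `u` takes the value `s`. -/
def descentInv (u v : ℝ → ℝ) (R s : ℝ) : ℝ := Function.invFunOn u (descent v R) s

/-- The functional `K E + h (F/f)(u) u'` along a solution. -/
def pohozaev (f q u v : ℝ → ℝ) (r : ℝ) : ℝ :=
  hInt q r * energy f u v r + hfun q r * (Fint f (u r) / f (u r)) * v r

/-- The functional `K (p²/2 + F) - h (F/f) p` along a branch. -/
def branchPohozaev (f q r p : ℝ → ℝ) (s : ℝ) : ℝ :=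
  hInt q (r s) * (p s ^ 2 / 2 + Fint f s) - hfun q (r s) * (Fint f s / f s) * p s

namespace BoundOrbit

variable {c : EReal} {f q u v : ℝ → ℝ} {a b β C R : ℝ}

lemma injOn_descent (ho : BoundOrbit c f q u v) (hR : 0 ≤ R) : InjOn u (descent v R) := by
  intro x hx y hy hxy
  rcases lt_trichotomy x y with h | h | h
  · exact absurd hxy (ho.lt_of_mem_descent hR hy hx.1.le h).ne'
  · exact h
  · exact absurd hxy (ho.lt_of_mem_descent hR hx hy.1.le h).ne

lemma descentInv_mem {l s : ℝ} (hl : ∀ s ∈ Ioo l (u R), ∃ r ∈ descent v R, u r = s)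
    (hs : s ∈ Ioo l (u R)) : descentInv u v R s ∈ descent v R :=
  Function.invFunOn_mem (hl s hs)

lemma apply_descentInv {l s : ℝ} (hl : ∀ s ∈ Ioo l (u R), ∃ r ∈ descent v R, u r = s)
    (hs : s ∈ Ioo l (u R)) : u (descentInv u v R s) = s :=
  Function.invFunOn_eq (hl s hs)

lemma descentInv_apply (ho : BoundOrbit c f q u v) (hR : 0 ≤ R) {r : ℝ}
    (hr : r ∈ descent v R) : descentInv u v R (u r) = r :=
  ho.injOn_descent hR (Function.invFunOn_mem ⟨r, hr, rfl⟩) hr (Function.invFunOn_eq ⟨r, hr, rfl⟩)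

lemma continuousAt_descentInv (ho : BoundOrbit c f q u v) (hR : 0 ≤ R) {l s : ℝ}
    (hl : ∀ s ∈ Ioo l (u R), ∃ r ∈ descent v R, u r = s) (hs : s ∈ Ioo l (u R)) :
    ContinuousAt (descentInv u v R) s := by
  have hm := descentInv_mem hl hs
  have he := apply_descentInv hl hs
  have hI := Ioo_mem_nhds hs.1 hs.2
  refine tendsto_order.2 ⟨fun x hx => ?_, fun x hx => ?_⟩
  · have hm1 : max x R < descentInv u v R s := max_lt hx hm.1
    obtain ⟨y, hy, hy2⟩ := exists_between hm1
    have hRy : R < y := (le_max_right x R).trans_lt hy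
    have h1 := ho.lt_of_mem_descent hR hm hRy.le hy2
    rw [he] at h1
    filter_upwards [hI, gt_mem_nhds h1] with t ht ht2
    by_contra! h2
    have h3 : descentInv u v R t < y := h2.trans_lt ((le_max_left x R).trans_lt hy)
    have h4 := ho.lt_of_mem_descent hR (descent_of_lt hm hRy hy2.le)
      (descentInv_mem hl ht).1.le h3
    rw [apply_descentInv hl ht] at h4
    exact lt_asymm ht2 h4
  · obtain ⟨y, hy, hy1, hy2⟩ := ho.exists_gt_mem_descent hR hm hx
    have h1 := ho.lt_of_mem_descent hR hy hm.1.le hy1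
    rw [he] at h1
    filter_upwards [hI, lt_mem_nhds h1] with t ht ht2
    by_contra! h2
    have h4 := ho.lt_of_mem_descent hR (descentInv_mem hl ht) hy.1.le (hy2.trans_le h2)
    rw [apply_descentInv hl ht] at h4
    exact lt_asymm ht2 h4

lemma energy_pos_of_deriv_ne (hf : AdmissibleNonlinearity c f b β C)
    (hq : AdmissibleWeight q a C) (ho : BoundOrbit c f q u v) {r : ℝ} (hr : 0 ≤ r)
    (hv : v r ≠ 0) : 0 < energy f u v r :=
  lt_of_le_of_ne (ho.energy_nonneg hf hq hr) fun h =>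
    hv (ho.eq_zero_of_energy_eq_zero hf hq hr h.symm le_rfl).2

lemma branch (hf : AdmissibleNonlinearity c f b β C) (hq : AdmissibleWeight q a C)
    (ho : BoundOrbit c f q u v) (hR : 0 ≤ R) {l : ℝ}
    (hl : ∀ s ∈ Ioo l (u R), ∃ r ∈ descent v R, u r = s) :
    Branch c f q l (u R) (descentInv u v R) (fun s => -v (descentInv u v R s)) := by
  have hm : ∀ s ∈ Ioo l (u R), descentInv u v R s ∈ descent v R := fun s hs => descentInv_mem hl hs
  have he : ∀ s ∈ Ioo l (u R), u (descentInv u v R s) = s := fun s hs => apply_descentInv hl hs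
  have hpos : ∀ s ∈ Ioo l (u R), 0 < descentInv u v R s := fun s hs => hR.trans_lt (hm s hs).1
  have hneg : ∀ s ∈ Ioo l (u R), v (descentInv u v R s) < 0 := fun s hs =>
    (hm s hs).2 _ ⟨(hm s hs).1, le_rfl⟩
  have hrd : ∀ s ∈ Ioo l (u R),
      HasDerivAt (descentInv u v R) (-(1 / -v (descentInv u v R s))) s := by
    intro s hs
    refine (HasDerivAt.of_local_left_inverse (ho.continuousAt_descentInv hR hl hs)
      (ho.hasDerivAt _ (hpos s hs)) (hneg s hs).ne ?_).congr_deriv ?_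
    · filter_upwards [Ioo_mem_nhds hs.1 hs.2] with t ht using he t ht
    · rw [one_div, inv_neg, neg_neg]
  refine ⟨fun s hs => ?_, hpos, fun s hs => neg_pos.2 (hneg s hs), hrd, fun s hs => ?_,
    fun s hs => ?_⟩
  · have := ho.mem _ (hpos s hs).le
    rwa [he s hs] at this
  · refine ((ho.hasDerivAt_deriv _ (hpos s hs)).comp s (hrd s hs)).neg.congr_deriv ?_
    have := (hneg s hs).ne
    rw [he s hs]
    field_simp
    ring
  · have := ho.energy_pos_of_deriv_ne hf hq (hpos s hs).le (hneg s hs).ne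
    rw [energy, he s hs] at this
    linarith [neg_sq (v (descentInv u v R s))]

lemma branchPohozaev_eq {l s : ℝ} (hl : ∀ s ∈ Ioo l (u R), ∃ r ∈ descent v R, u r = s)
    (hs : s ∈ Ioo l (u R)) :
    branchPohozaev f q (descentInv u v R) (fun s => -v (descentInv u v R s)) s =
      pohozaev f q u v (descentInv u v R s) := by
  unfold branchPohozaev pohozaev energy
  rw [apply_descentInv hl hs]
  ring

lemma descentInv_tendsto (hf : AdmissibleNonlinearity c f b β C) (hq : AdmissibleWeight q a C)
    (ho : BoundOrbit c f q u v) (hR : 0 ≤ R) (hv : v R = 0) (hu : β < u R) {l : ℝ}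
    (hlu : l < u R) (hl : ∀ s ∈ Ioo l (u R), ∃ r ∈ descent v R, u r = s) :
    Tendsto (descentInv u v R) (𝓝[<] (u R)) (𝓝[>] R) := by
  have hI : Ioo l (u R) ∈ 𝓝[<] (u R) := Ioo_mem_nhdsLT hlu
  refine tendsto_nhdsWithin_iff.2 ⟨tendsto_order.2 ⟨fun x hx => ?_, fun x hx => ?_⟩, ?_⟩
  · filter_upwards [hI] with s hs using hx.trans (descentInv_mem hl hs).1
  · obtain ⟨y, hy, hy2⟩ := ((ho.eventually_mem_descent hf hq hR hv hu).and
      (Ioo_mem_nhdsGT hx)).exists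
    have h1 := ho.lt_of_mem_descent hR hy le_rfl hy.1
    filter_upwards [hI, Ioo_mem_nhdsLT h1] with s hs hs2
    by_contra! h2
    have h4 := ho.lt_of_mem_descent hR (descentInv_mem hl hs) hy.1.le (hy2.2.trans_le h2)
    rw [apply_descentInv hl hs] at h4
    exact lt_asymm hs2.1 h4
  · filter_upwards [hI] with s hs using (descentInv_mem hl hs).1

lemma pohozaev_tendsto (hf : AdmissibleNonlinearity c f b β C) (hq : AdmissibleWeight q a C)
    (ho : BoundOrbit c f q u v) (hR : 0 ≤ R) (hv : v R = 0) (hu : β < u R) :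
    Tendsto (pohozaev f q u v) (𝓝[>] R) (𝓝 (hInt q R * Fint f (u R))) := by
  have hle : 𝓝[>] R ≤ 𝓝[Ici 0] R :=
    nhdsWithin_mono _ fun x hx => hR.trans (le_of_lt hx)
  have h1 : Tendsto (energy f u v) (𝓝[>] R) (𝓝 (Fint f (u R))) := by
    have h := (ho.energy_continuousOn hf R hR).tendsto.mono_left hle
    simpa [energy, hv] using h
  have h2 : Tendsto v (𝓝[>] R) (𝓝 0) := by
    have h := (ho.continuousOn_deriv R hR).tendsto.mono_left hle
    rwa [hv] at h
  have hu' : Tendsto u (𝓝[>] R) (𝓝 (u R)) := (ho.continuousOn R hR).tendsto.mono_left hle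
  have hmem := ho.mem R hR
  have hne : f (u R) ≠ 0 := hf.f_ne hmem ((hf.b_lt.trans hu).trans_le (le_abs_self _))
  have h3 : Tendsto (fun r => Fint f (u r) / f (u r)) (𝓝[>] R) (𝓝 (Fint f (u R) / f (u R))) :=
    ((hf.F_hasDerivAt _ hmem).continuousAt.tendsto.comp hu').div
      ((hf.continuousAt _ hmem).tendsto.comp hu') hne
  have h4 : Tendsto (hInt q) (𝓝[>] R) (𝓝 (hInt q R)) := by
    rcases eq_or_lt_of_le hR with h | h
    · rw [← h]
      simpa [hInt] using hq.K_tendsto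
    · exact (hq.K_hasDerivAt R h).continuousAt.tendsto.mono_left nhdsWithin_le_nhds
  have h5 : Tendsto (fun r => hfun q r * v r) (𝓝[>] R) (𝓝 0) := by
    have hb : ∀ᶠ r in 𝓝[>] R, ‖hfun q r * v r‖ ≤ hfun q (R + 1) * |v r| := by
      filter_upwards [Ioo_mem_nhdsGT (lt_add_one R)] with r hr
      have hr0 := hR.trans_lt hr.1
      rw [norm_mul, Real.norm_eq_abs, Real.norm_eq_abs, abs_of_pos (hq.h_pos r hr0)]
      exact mul_le_mul_of_nonneg_right
        (hq.h_mono.monotoneOn hr0 (mem_Ioi.2 (by linarith)) hr.2.le) (abs_nonneg _)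
    refine squeeze_zero_norm' hb ?_
    simpa using h2.abs.const_mul (hfun q (R + 1))
  have h6 := (h4.mul h1).add (h3.mul h5)
  rw [mul_zero, add_zero] at h6
  refine h6.congr fun r => ?_
  unfold pohozaev
  ring

lemma pohozaev_hasDerivAt (hf : AdmissibleNonlinearity c f b β C) (hq : AdmissibleWeight q a C)
    (ho : BoundOrbit c f q u v) {r : ℝ} (hr : 0 < r) (hu : b < |u r|) :
    HasDerivAt (pohozaev f q u v)
      (hfun q r * v r ^ 2 * (deriv (fun t => Fint f t / f t) (u r) - Gfun q r) -
        Fint f (u r) / f (u r) * v r) r := by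
  have hmem := ho.mem r hr.le
  have hg := (hf.ratio_hasDerivAt hmem hu).comp r (ho.hasDerivAt r hr)
  refine (((hq.K_hasDerivAt r hr).mul (ho.energy_hasDerivAt hf hr)).add
    (((hq.h_hasDerivAt r hr).mul hg).mul (ho.hasDerivAt_deriv r hr))).congr_deriv ?_
  have h1 := hq.damping_mul_h r hr
  have h2 := (hq.h_pos r hr).ne'
  have h3 := hf.f_ne hmem hu
  have h4 : hfun q r * Gfun q r = damping q r * hInt q r - hfun q r / 2 := by
    rw [Gfun_eq]
    field_simp
  have h5 : Fint f (u r) / f (u r) * f (u r) = Fint f (u r) := div_mul_cancel₀ _ h3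
  simp only [Function.comp_apply, Pi.mul_apply, energy]
  linear_combination (v r ^ 2) * h4 - (Fint f (u r) / f (u r) * v r) * h1 - hfun q r * h5

/-- Up to a primitive of `F/f`, the functional is nondecreasing where `u > β`. -/
lemma exists_monotoneOn_pohozaev (hf : AdmissibleNonlinearity c f b β C)
    (hq : AdmissibleWeight q a C) (ho : BoundOrbit c f q u v) {r₂ : ℝ}
    (hR : 0 ≤ R) (h : R ≤ r₂) (hu : ∀ t ∈ Icc R r₂, β < u t) :
    ∃ Ψ : ℝ → ℝ, (∀ s, β < s → InCC c s → HasDerivAt Ψ (Fint f s / f s) s) ∧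
      MonotoneOn (fun r => pohozaev f q u v r + Ψ (u r)) (Icc R r₂ ∩ Ioi 0) := by
  have hc : ContinuousOn (fun s => Fint f s / f s) {s | β < s ∧ InCC c s} := fun s hs =>
    (hf.ratio_hasDerivAt hs.2 ((hf.b_lt.trans hs.1).trans_le
      (le_abs_self s))).continuousAt.continuousWithinAt
  have hopen : IsOpen {s | β < s ∧ InCC c s} := isOpen_Ioi.inter (isOpen_inCC c)
  have hmemR := ho.mem R hR
  have hΨ : ∀ s, β < s → InCC c s →
      HasDerivAt (fun s => ∫ t in (u R)..s, Fint f t / f t) (Fint f s / f s) s := by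
    intro s hs hsc
    refine intervalIntegral.integral_hasDerivAt_right ((hc.mono ?_).intervalIntegrable)
      (hc.stronglyMeasurableAtFilter hopen s ⟨hs, hsc⟩)
      (hc.continuousAt (hopen.mem_nhds ⟨hs, hsc⟩))
    intro x hx
    have hβR := hu R ⟨le_rfl, h⟩
    refine ⟨(lt_min hβR hs).trans_le hx.1, ?_⟩
    rcases le_total (u R) s with h1 | h1
    · rw [uIcc_of_le h1] at hx; exact hmemR.mem_Icc hsc hx
    · rw [uIcc_of_ge h1] at hx; exact hsc.mem_Icc hmemR hx
  refine ⟨_, hΨ, ?_⟩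
  have hd : ∀ r ∈ Icc R r₂ ∩ Ioi 0, HasDerivAt
      (fun r => pohozaev f q u v r + ∫ t in (u R)..(u r), Fint f t / f t)
      (hfun q r * v r ^ 2 * (deriv (fun t => Fint f t / f t) (u r) - Gfun q r)) r := by
    intro r hr
    have hr0 : 0 < r := hr.2
    have hβ := hu r hr.1
    refine ((ho.pohozaev_hasDerivAt hf hq hr0 ((hf.b_lt.trans hβ).trans_le (le_abs_self _))).add
      ((hΨ _ hβ (ho.mem r hr0.le)).comp r (ho.hasDerivAt r hr0))).congr_deriv ?_
    ring
  apply monotoneOn_of_deriv_nonneg ((convex_Icc R r₂).inter (convex_Ioi 0))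
  · exact fun r hr => (hd r hr).continuousAt.continuousWithinAt
  · exact fun r hr => (hd r (interior_subset hr)).differentiableAt.differentiableWithinAt
  · intro r hr
    have hr := interior_subset hr
    have hr0 : 0 < r := hr.2
    rw [(hd r hr).deriv]
    have h1 := hf.le_deriv_ratio' (ho.mem r hr0.le)
      ((hu r hr.1).trans_le (le_abs_self _))
    have h2 := hq.G_le r hr0
    have h3 := hq.h_pos r hr0
    have : 0 ≤ deriv (fun t => Fint f t / f t) (u r) - Gfun q r := by linarith
    positivity

lemma pohozaev_le_of_eq (hf : AdmissibleNonlinearity c f b β C)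
    (hq : AdmissibleWeight q a C) (ho : BoundOrbit c f q u v) {r₁ r₂ : ℝ}
    (h₁ : 0 < r₁) (h₁₂ : r₁ ≤ r₂) (hu : ∀ t ∈ Icc r₁ r₂, β < u t) (heq : u r₁ = u r₂) :
    pohozaev f q u v r₁ ≤ pohozaev f q u v r₂ := by
  obtain ⟨Ψ, -, hmono⟩ := ho.exists_monotoneOn_pohozaev hf hq h₁.le h₁₂ hu
  have h := hmono ⟨⟨le_rfl, h₁₂⟩, h₁⟩ ⟨⟨h₁₂, le_rfl⟩, h₁.trans_le h₁₂⟩ h₁₂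
  simp only [heq] at h
  linarith

lemma pohozaev_pos (hf : AdmissibleNonlinearity c f b β C)
    (hq : AdmissibleWeight q a C) (ho : BoundOrbit c f q u v) {ρ : ℝ}
    (hρ : ρ ∈ descent v 0) (hu : β < u ρ) : 0 < pohozaev f q u v ρ := by
  have hanti := ho.strictAntiOn_descent le_rfl hρ
  have hβ : ∀ t ∈ Icc 0 ρ, β < u t := fun t ht =>
    hu.trans_le (hanti.antitoneOn ht ⟨hρ.1.le, le_rfl⟩ ht.2)
  obtain ⟨Ψ, hΨ, hmono⟩ := ho.exists_monotoneOn_pohozaev hf hq le_rfl hρ.1.le hβ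
  have h0 : u ρ < u 0 := ho.lt_of_mem_descent le_rfl hρ le_rfl hρ.1
  have hlim : Tendsto (fun r => pohozaev f q u v r + Ψ (u r)) (𝓝[>] 0) (𝓝 (0 + Ψ (u 0))) := by
    have h1 := ho.pohozaev_tendsto hf hq le_rfl ho.deriv_zero (hu.trans h0)
    rw [show hInt q 0 = 0 by simp [hInt], zero_mul] at h1
    refine h1.add ?_
    exact (hΨ _ (hu.trans h0) (ho.mem 0 le_rfl)).continuousAt.tendsto.comp
      ((ho.continuousOn 0 self_mem_Ici).tendsto.mono_left
        (nhdsWithin_mono _ Ioi_subset_Ici_self))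
  have hle : 0 + Ψ (u 0) ≤ pohozaev f q u v ρ + Ψ (u ρ) := by
    refine le_of_tendsto hlim ?_
    filter_upwards [Ioo_mem_nhdsGT hρ.1] with r hr
    exact hmono ⟨⟨hr.1.le, hr.2.le⟩, hr.1⟩ ⟨⟨hρ.1.le, le_rfl⟩, hρ.1⟩ hr.2.le
  have hmem : ∀ s ∈ Icc (u ρ) (u 0), InCC c s := fun s hs =>
    (ho.mem ρ hρ.1.le).mem_Icc (ho.mem 0 le_rfl) hs
  have hΨlt : Ψ (u ρ) < Ψ (u 0) := by
    refine strictMonoOn_of_deriv_pos (convex_Icc (u ρ) (u 0)) (fun s hs =>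
      (hΨ s (hu.trans_le hs.1) (hmem s hs)).continuousAt.continuousWithinAt) (fun s hs => ?_)
      ⟨le_rfl, h0.le⟩ ⟨h0.le, le_rfl⟩ h0
    have hs := interior_subset hs
    have hβs := hu.trans_le hs.1
    rw [(hΨ s hβs (hmem s hs)).deriv]
    exact div_pos (hf.F_pos s hβs (hmem s hs).2) (hf.pos s (hf.b_lt.trans hβs) (hmem s hs).2)
  linarith

end BoundOrbit

namespace EndsAt

variable {c : EReal} {f q u v : ℝ → ℝ} {a b β C R R' : ℝ}

lemma exists_eq (ho : BoundOrbit c f q u v) (hR : 0 ≤ R) (he : EndsAt u v β R R') :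
    ∀ s ∈ Ioo (u R') (u R), ∃ r ∈ descent v R, u r = s := by
  intro s hs
  obtain ⟨r, hr, hr2⟩ := intermediate_value_Ioo' he.1.le
    (ho.continuousOn.mono fun x hx => hR.trans hx.1) hs
  exact ⟨r, ⟨hr.1, fun t ht => he.2.2.2 t ⟨ht.1, ht.2.trans_lt hr.2⟩⟩, hr2⟩

lemma lt_of_mem_descent (he : EndsAt u v β R R') {r : ℝ} (hr : r ∈ descent v R) : r < R' := by
  by_contra! h
  exact absurd he.2.1 (hr.2 R' ⟨he.1, h⟩).ne

lemma descentInv_tendsto (ho : BoundOrbit c f q u v) (hR : 0 ≤ R) (he : EndsAt u v β R R')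
    (hlu : u R' < u R) : Tendsto (descentInv u v R) (𝓝[>] (u R')) (𝓝 R') := by
  have hl := he.exists_eq ho hR
  have hI : Ioo (u R') (u R) ∈ 𝓝[>] (u R') := Ioo_mem_nhdsGT hlu
  refine tendsto_order.2 ⟨fun x hx => ?_, fun x hx => ?_⟩
  · obtain ⟨y, hy, hy2⟩ := exists_between (max_lt hx he.1)
    have hRy : R < y := (le_max_right x R).trans_lt hy
    have hanti : StrictAntiOn u (Icc R R') := by
      apply strictAntiOn_of_deriv_neg (convex_Icc R R')
      · exact ho.continuousOn.mono fun x hx => hR.trans hx.1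
      · intro x hx
        rw [interior_Icc] at hx
        rw [(ho.hasDerivAt x (hR.trans_lt hx.1)).deriv]
        exact he.2.2.2 x hx
    have h1 := hanti ⟨hRy.le, hy2.le⟩ ⟨he.1.le, le_rfl⟩ hy2
    filter_upwards [hI, Ioo_mem_nhdsGT h1] with s hs hs2
    by_contra! h2
    have hm := BoundOrbit.descentInv_mem hl hs
    have h3 := hanti ⟨hm.1.le, (he.lt_of_mem_descent hm).le⟩ ⟨hRy.le, hy2.le⟩
      (h2.trans_lt ((le_max_left x R).trans_lt hy))
    rw [BoundOrbit.apply_descentInv hl hs] at h3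
    exact lt_asymm hs2.2 h3
  · filter_upwards [hI] with s hs
    exact (he.lt_of_mem_descent (BoundOrbit.descentInv_mem hl hs)).trans hx

end EndsAt

lemma sub_le_sub_of_hasDerivAt_le {X Y X' Y' : ℝ → ℝ} {x y : ℝ} (hxy : x ≤ y)
    (hX : ∀ s ∈ Icc x y, HasDerivAt X (X' s) s) (hY : ∀ s ∈ Icc x y, HasDerivAt Y (Y' s) s)
    (hle : ∀ s ∈ Ioo x y, X' s ≤ Y' s) : X y - Y y ≤ X x - Y x := by
  have hd : ∀ s ∈ Icc x y, HasDerivAt (fun s => X s - Y s) (X' s - Y' s) s := fun s hs =>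
    (hX s hs).sub (hY s hs)
  refine antitoneOn_of_deriv_nonpos (convex_Icc x y)
    (fun s hs => (hd s hs).continuousAt.continuousWithinAt)
    (fun s hs => (hd s (interior_subset hs)).differentiableAt.differentiableWithinAt)
    (fun s hs => ?_) ⟨le_rfl, hxy⟩ ⟨hxy, le_rfl⟩ hxy
  rw [(hd s (interior_subset hs)).deriv]
  rw [interior_Icc] at hs
  linarith [hle s hs]

/-- Propagation of a property downwards along an open interval. -/
lemma forall_mem_Ioo_of_downward {l M : ℝ} {P : ℝ → Prop} (near : ∀ᶠ s in 𝓝[<] M, P s)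
    (hopen : ∀ s ∈ Ioo l M, P s → ∀ᶠ t in 𝓝 s, P t)
    (step : ∀ s ∈ Ioo l M, (∀ t ∈ Ioo s M, P t) → P s) : ∀ s ∈ Ioo l M, P s := by
  intro s hs
  by_contra hP
  obtain ⟨w, hw, hw2⟩ := (mem_nhdsLT_iff_exists_Ioo_subset).1 near
  set T := {x | s ≤ x ∧ x < M ∧ ∀ t ∈ Ioo x M, P t} with hT
  have hTne : T.Nonempty := ⟨max w s, le_max_right _ _, max_lt hw hs.2, fun t ht =>
    hw2 ⟨(le_max_left _ _).trans_lt ht.1, ht.2⟩⟩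
  have hTb : BddBelow T := ⟨s, fun x hx => hx.1⟩
  obtain ⟨z, hz⟩ := hTne
  have hsle : s ≤ sInf T := le_csInf ⟨z, hz⟩ fun x hx => hx.1
  have hltM : sInf T < M := (csInf_le hTb hz).trans_lt hz.2.1
  have hall : ∀ t ∈ Ioo (sInf T) M, P t := by
    intro t ht
    obtain ⟨x, hx, hxt⟩ := exists_lt_of_csInf_lt ⟨z, hz⟩ ht.1
    exact hx.2.2 t ⟨hxt, ht.2⟩
  have hmem : sInf T ∈ Ioo l M := ⟨hs.1.trans_le hsle, hltM⟩
  have hPi := step _ hmem hall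
  have hslt : s < sInf T := lt_of_le_of_ne hsle fun h => hP (h ▸ hPi)
  obtain ⟨ε, hε, hε2⟩ := Metric.eventually_nhds_iff.1 (hopen _ hmem hPi)
  have hm : 0 < min (ε / 2) (sInf T - s) := lt_min (by linarith) (by linarith)
  have hnew : sInf T - min (ε / 2) (sInf T - s) ∈ T := by
    refine ⟨by linarith [min_le_right (ε / 2) (sInf T - s)], by linarith, fun t ht => ?_⟩
    rcases lt_or_ge (sInf T) t with h | h
    · exact hall t ⟨h, ht.2⟩
    · apply hε2
      rw [Real.dist_eq, abs_sub_lt_iff]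
      constructor <;> linarith [min_le_left (ε / 2) (sInf T - s), ht.1]
  linarith [csInf_le hTb hnew]

/-- The quantity `K (p² + 2 min (F, 0))` along a branch. -/
def branchLevel (f q r p : ℝ → ℝ) (s : ℝ) : ℝ :=
  hInt q (r s) * (p s ^ 2 + 2 * min (Fint f s) 0)

/-- At the value `s` the first branch is steeper than the second one, in the two senses used by
the comparison argument. -/
def Dominates (f q rA pA rB pB : ℝ → ℝ) (s : ℝ) : Prop :=
  pB s < pA s ∧ branchLevel f q rB pB s < branchLevel f q rA pA s

namespace Branch

variable {c : EReal} {f q rA pA rB pB r p : ℝ → ℝ} {a b β C l M : ℝ}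

lemma K_hasDerivAt (hq : AdmissibleWeight q a C) (h : Branch c f q l M r p) {s : ℝ}
    (hs : s ∈ Ioo l M) :
    HasDerivAt (fun s => hInt q (r s)) (hfun q (r s) * (-(1 / p s))) s :=
  (hq.K_hasDerivAt _ (h.r_pos s hs)).comp s (h.r_hasDerivAt s hs)

lemma h_hasDerivAt (hq : AdmissibleWeight q a C) (h : Branch c f q l M r p) {s : ℝ}
    (hs : s ∈ Ioo l M) :
    HasDerivAt (fun s => hfun q (r s)) (deriv (hfun q) (r s) * (-(1 / p s))) s :=
  (hq.h_hasDerivAt _ (h.r_pos s hs)).comp s (h.r_hasDerivAt s hs)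

lemma pohozaev_hasDerivAt (hf : AdmissibleNonlinearity c f b β C) (hq : AdmissibleWeight q a C)
    (h : Branch c f q l M r p) {s : ℝ} (hs : s ∈ Ioo l M) (hb : b < |s|) :
    HasDerivAt (branchPohozaev f q r p)
      (-(hfun q (r s) * p s * (deriv (fun t => Fint f t / f t) s - Gfun q (r s))) -
        Fint f s / f s) s := by
  have hr := h.r_pos s hs
  have hp := (h.p_pos s hs).ne'
  have hmem := h.mem s hs
  have hpd := h.p_hasDerivAt s hs
  refine (((h.K_hasDerivAt hq hs).mul (((hpd.pow 2).div_const 2).add (hf.F_hasDerivAt s hmem))).sub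
    (((h.h_hasDerivAt hq hs).mul (hf.ratio_hasDerivAt hmem hb)).mul hpd)).congr_deriv ?_
  have h1 := hq.damping_mul_h _ hr
  have h2 := (hq.h_pos _ hr).ne'
  have h3 := hf.f_ne hmem hb
  have h4 : hfun q (r s) * Gfun q (r s) = damping q (r s) * hInt q (r s) - hfun q (r s) / 2 := by
    rw [Gfun_eq]
    field_simp
  have h5 : Fint f s / f s * f s = Fint f s := div_mul_cancel₀ _ h3
  simp only [Pi.pow_apply, Pi.mul_apply, Pi.add_apply]
  generalize deriv (fun t => Fint f t / f t) s = g
  generalize Fint f s / f s = y at *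
  rw [← h5]
  field_simp
  push_cast
  linear_combination (-2 * (p s) ^ 2) * h4 - (2 * y * p s) * h1

lemma level_hasDerivAt (hq : AdmissibleWeight q a C)
    (h : Branch c f q l M r p) {s : ℝ} (hs : s ∈ Ioo l M) {φ : ℝ → ℝ} {φ' : ℝ}
    (hφ : HasDerivAt φ φ' s) (hpos : 0 < p s ^ 2 + 2 * φ s) :
    HasDerivAt (fun s => √(hInt q (r s) * (p s ^ 2 + 2 * φ s)))
      ((hfun q (r s) * Gfun q (r s) * p s - hfun q (r s) * φ s / p s +
        hInt q (r s) * (φ' - f s)) / √(hInt q (r s) * (p s ^ 2 + 2 * φ s))) s := by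
  have hr := h.r_pos s hs
  have hp := (h.p_pos s hs).ne'
  have hpd := h.p_hasDerivAt s hs
  have hK := hq.K_pos _ hr
  refine (((h.K_hasDerivAt hq hs).mul ((hpd.pow 2).add (hφ.const_mul 2))).sqrt
    (mul_pos hK hpos).ne').congr_deriv ?_
  have h2 := (hq.h_pos _ hr).ne'
  have h4 : hfun q (r s) * Gfun q (r s) = damping q (r s) * hInt q (r s) - hfun q (r s) / 2 := by
    rw [Gfun_eq]
    field_simp
  have h5 : √(hInt q (r s) * (p s ^ 2 + 2 * φ s)) ≠ 0 := (Real.sqrt_pos.2 (mul_pos hK hpos)).ne'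
  simp only [Pi.pow_apply, Pi.mul_apply, Pi.add_apply]
  rw [h4]
  generalize √(hInt q (r s) * (p s ^ 2 + 2 * φ s)) = w at *
  field_simp
  push_cast
  ring

lemma radius_sub_le (hA : Branch c f q l M rA pA) (hB : Branch c f q l M rB pB) {x y : ℝ} (hxy : x ≤ y) (hx : l < x) (hy : y < M)
    (hp : ∀ s ∈ Ioo x y, pB s < pA s) : rA x - rB x ≤ rA y - rB y := by
  have hI : Icc x y ⊆ Ioo l M := fun s hs => ⟨hx.trans_le hs.1, hs.2.trans_lt hy⟩
  have := sub_le_sub_of_hasDerivAt_le hxy (fun s hs => hB.r_hasDerivAt s (hI hs))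
    (fun s hs => hA.r_hasDerivAt s (hI hs)) (fun s hs => ?_)
  · linarith
  · have h1 := one_div_le_one_div_of_le (hB.p_pos s (hI (Ioo_subset_Icc_self hs))) (hp s hs).le
    linarith

end Branch

lemma div_sqrt_le_div_sqrt {x y z : ℝ} (hy : 0 < y) (hyx : y ≤ x) (hz : z ≤ 0)
    (hpos : 0 < y ^ 2 + 2 * z) : x / √(x ^ 2 + 2 * z) ≤ y / √(y ^ 2 + 2 * z) := by
  have hx : 0 < x := hy.trans_le hyx
  have hxpos : 0 < x ^ 2 + 2 * z := by nlinarith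
  rw [div_le_div_iff₀ (Real.sqrt_pos.2 hxpos) (Real.sqrt_pos.2 hpos)]
  refine (sq_le_sq₀ (by positivity) (by positivity)).1 ?_
  rw [mul_pow, mul_pow, Real.sq_sqrt hpos.le, Real.sq_sqrt hxpos.le]
  have h : 0 ≤ x ^ 2 - y ^ 2 := sub_nonneg.2 (pow_le_pow_left₀ hy.le hyx 2)
  nlinarith [mul_nonneg (neg_nonneg.2 hz) h]

namespace Branch

variable {c : EReal} {f q rA pA rB pB r p : ℝ → ℝ} {a b β C l M : ℝ}

/-- If the first branch is farther out and steeper on `(x, y]`, it is steeper at `x`. -/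
lemma lt_of_radius_le (hf : AdmissibleNonlinearity c f b β C) (hq : AdmissibleWeight q a C)
    (hA : Branch c f q l M rA pA) (hB : Branch c f q l M rB pB) {x y : ℝ} (hxy : x < y)
    (hx : l < x) (hy : y < M) (hp : ∀ s ∈ Ioc x y, pB s < pA s)
    (hr : ∀ s ∈ Ioo x y, rB s ≤ rA s) : pB x < pA x := by
  have hI : Icc x y ⊆ Ioo l M := fun s hs => ⟨hx.trans_le hs.1, hs.2.trans_lt hy⟩
  have hc : ContinuousOn (fun s => f s / (pA s * pB s)) (Icc x y) := fun s hs =>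
    ((hf.continuousAt s (hA.mem s (hI hs))).div
      ((hA.p_hasDerivAt s (hI hs)).continuousAt.mul (hB.p_hasDerivAt s (hI hs)).continuousAt)
      (mul_pos (hA.p_pos s (hI hs)) (hB.p_pos s (hI hs))).ne').continuousWithinAt
  obtain ⟨Λ, hΛ⟩ := isCompact_Icc.exists_bound_of_continuousOn hc
  have hd : ∀ s ∈ Icc x y, HasDerivAt (fun s => (pA s - pB s) * Real.exp (-Λ * s))
      (((damping q (rA s) - damping q (rB s)) + (f s / (pA s * pB s) - Λ) * (pA s - pB s)) *
        Real.exp (-Λ * s)) s := by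
    intro s hs
    refine (((hA.p_hasDerivAt s (hI hs)).sub (hB.p_hasDerivAt s (hI hs))).mul
      ((hasDerivAt_id s).const_mul (-Λ)).exp).congr_deriv ?_
    have h1 := (hA.p_pos s (hI hs)).ne'
    have h2 := (hB.p_pos s (hI hs)).ne'
    simp only [Pi.sub_apply, id]
    field_simp
    ring
  have h := sub_le_sub_of_hasDerivAt_le hxy.le hd (fun s _ => hasDerivAt_const s (0 : ℝ))
    fun s hs => ?_
  · have h1 := mul_pos (sub_pos.2 (hp y ⟨hxy, le_rfl⟩)) (Real.exp_pos (-Λ * y))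
    have h2 : 0 < (pA x - pB x) * Real.exp (-Λ * x) := by linarith
    exact sub_pos.1 ((mul_pos_iff_of_pos_right (Real.exp_pos _)).1 h2)
  · have hs' := Ioo_subset_Icc_self hs
    have h1 := hq.damping_anti (hB.r_pos s (hI hs')) (hA.r_pos s (hI hs')) (hr s hs)
    have h2 := (abs_le.1 (hΛ s hs')).2
    have h3 := hp s ⟨hs.1, hs.2.le⟩
    refine mul_nonpos_of_nonpos_of_nonneg ?_ (Real.exp_pos _).le
    nlinarith [mul_nonneg (sub_nonneg.2 h2) (sub_pos.2 h3).le]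

lemma level_of_beta_le (hf : AdmissibleNonlinearity c f b β C)
    (h : Branch c f q l M r p) {s : ℝ} (hs : s ∈ Ioo l M) (hβ : β ≤ |s|) :
    branchLevel f q r p s = hInt q (r s) * p s ^ 2 := by
  have h0 : 0 ≤ Fint f s := by
    rcases eq_or_lt_of_le hβ with h1 | h1
    · rw [← hf.F_abs, ← h1, hf.F_β]
    · exact (hf.F_pos' (h.mem s hs) h1).le
  rw [branchLevel, min_eq_right h0, mul_zero, add_zero]

lemma level_of_le_beta (hf : AdmissibleNonlinearity c f b β C) {s : ℝ} (hβ : |s| ≤ β) :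
    branchLevel f q r p s = hInt q (r s) * (p s ^ 2 + 2 * Fint f s) := by
  rw [branchLevel, min_eq_left (hf.F_nonpos s hβ)]

lemma level_pos (hq : AdmissibleWeight q a C) (h : Branch c f q l M r p) {s : ℝ}
    (hs : s ∈ Ioo l M) : 0 < branchLevel f q r p s := by
  refine mul_pos (hq.K_pos _ (h.r_pos s hs)) ?_
  rcases min_choice (Fint f s) 0 with h1 | h1 <;> rw [h1]
  · exact h.energy_pos s hs
  · have := h.p_pos s hs
    positivity

/-- The comparison of the two functionals in the region `|s| > β`. -/
lemma pohozaev_sub_le (hf : AdmissibleNonlinearity c f b β C) (hq : AdmissibleWeight q a C)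
    (hA : Branch c f q l M rA pA) (hB : Branch c f q l M rB pB) {x y : ℝ} (hxy : x ≤ y)
    (hx : l < x) (hy : y < M) (hb : ∀ s ∈ Icc x y, b < |s|)
    (hβ : ∀ s ∈ Ioo x y, β < |s|) (hdom : ∀ s ∈ Ioo x y, Dominates f q rA pA rB pB s) :
    branchPohozaev f q rA pA y - branchPohozaev f q rB pB y ≤
      branchPohozaev f q rA pA x - branchPohozaev f q rB pB x := by
  have hI : Icc x y ⊆ Ioo l M := fun s hs => ⟨hx.trans_le hs.1, hs.2.trans_lt hy⟩
  refine sub_le_sub_of_hasDerivAt_le hxy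
    (fun s hs => hA.pohozaev_hasDerivAt hf hq (hI hs) (hb s hs))
    (fun s hs => hB.pohozaev_hasDerivAt hf hq (hI hs) (hb s hs)) fun s hs => ?_
  have hs' := hI (Ioo_subset_Icc_self hs)
  obtain ⟨d1, d2⟩ := hdom s hs
  rw [hA.level_of_beta_le hf hs' (hβ s hs).le, hB.level_of_beta_le hf hs' (hβ s hs).le] at d2
  have hg := hf.le_deriv_ratio' (hA.mem s hs') (hβ s hs)
  generalize deriv (fun t => Fint f t / f t) s = g at *
  have hrA := hA.r_pos s hs'
  have hrB := hB.r_pos s hs'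
  have hpA := hA.p_pos s hs'
  have hpB := hB.p_pos s hs'
  have hhA := hq.h_pos _ hrA
  have hhB := hq.h_pos _ hrB
  have hGA := hq.G_le _ hrA
  have hGB := hq.G_le _ hrB
  suffices hfun q (rB s) * pB s * (g - Gfun q (rB s)) ≤
      hfun q (rA s) * pA s * (g - Gfun q (rA s)) by linarith
  rcases le_total (rB s) (rA s) with h | h
  · have key : ∀ t y : ℝ, 0 < t → hfun q t * y * (g - Gfun q t) =
        hfun q t * y * (g - C) +
          y * hfun q t ^ a * (hfun q t ^ (1 - a) * (C - Gfun q t)) := by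
      intro t y ht
      have h1 : hfun q t ^ a * hfun q t ^ (1 - a) = hfun q t := by
        rw [← Real.rpow_add (hq.h_pos t ht), add_sub_cancel, Real.rpow_one]
      linear_combination (-y * (C - Gfun q t)) * h1
    rw [key _ _ hrA, key _ _ hrB]
    have h1 : hfun q (rB s) ≤ hfun q (rA s) := hq.h_mono.monotoneOn hrB hrA h
    have h2 := hq.h_pow_mono hrB hrA h
    have h3 : hfun q (rB s) ^ a ≤ hfun q (rA s) ^ a :=
      Real.rpow_le_rpow hhB.le h1 hq.a_pos.le
    have h4 : 0 ≤ hfun q (rB s) ^ a := Real.rpow_nonneg hhB.le _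
    have h5 : 0 ≤ hfun q (rB s) ^ (1 - a) * (C - Gfun q (rB s)) :=
      mul_nonneg (Real.rpow_nonneg hhB.le _) (sub_nonneg.2 hGB)
    refine add_le_add (mul_le_mul_of_nonneg_right (mul_le_mul h1 d1.le hpB.le hhA.le)
      (sub_nonneg.2 hg)) ?_
    exact mul_le_mul (mul_le_mul d1.le h3 h4 hpA.le) h2 h5
      (mul_nonneg hpA.le (h4.trans h3))
  · have key : ∀ t y : ℝ, 0 < t → hfun q t * y * (g - Gfun q t) =
        √(hInt q t) * y * (g * (hfun q t / √(hInt q t)) -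
          Gfun q t * hfun q t / √(hInt q t)) := by
      intro t y ht
      have h1 := (Real.sqrt_pos.2 (hq.K_pos t ht)).ne'
      field_simp
    rw [key _ _ hrA, key _ _ hrB]
    have h1 := hq.ratio_anti hrA hrB h
    have h2 := hq.G_ratio_mono hrA hrB h
    have hKA := hq.K_pos _ hrA
    have hKB := hq.K_pos _ hrB
    have h0 : 0 ≤ g := (hq.G_nonneg _ hrA).trans (hGA.trans hg)
    have h3 : √(hInt q (rB s)) * pB s ≤ √(hInt q (rA s)) * pA s := by
      refine (sq_le_sq₀ (by positivity) (by positivity)).1 ?_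
      rw [mul_pow, mul_pow, Real.sq_sqrt hKA.le, Real.sq_sqrt hKB.le]
      exact d2.le
    have h4 : 0 ≤ g * (hfun q (rB s) / √(hInt q (rB s))) -
        Gfun q (rB s) * hfun q (rB s) / √(hInt q (rB s)) := by
      have h5 : 0 ≤ (g - Gfun q (rB s)) * (hfun q (rB s) / √(hInt q (rB s))) :=
        mul_nonneg (by linarith) (by positivity)
      linear_combination h5
    refine mul_le_mul h3 ?_ h4 (by positivity)
    simp only at h1 h2
    exact sub_le_sub (mul_le_mul_of_nonneg_left h1 h0) h2

lemma sqrt_level_sub_le_inner (hf : AdmissibleNonlinearity c f b β C)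
    (hq : AdmissibleWeight q a C)
    (hA : Branch c f q l M rA pA) (hB : Branch c f q l M rB pB) {x y : ℝ} (hxy : x ≤ y)
    (hx : l < x) (hy : y < M) (hβ : ∀ s ∈ Icc x y, |s| ≤ β)
    (hdom : ∀ s ∈ Ioo x y, Dominates f q rA pA rB pB s) (hr : ∀ s ∈ Ioo x y, rA s ≤ rB s) :
    √(branchLevel f q rA pA y) - √(branchLevel f q rB pB y) ≤
      √(branchLevel f q rA pA x) - √(branchLevel f q rB pB x) := by
  have hI : Icc x y ⊆ Ioo l M := fun s hs => ⟨hx.trans_le hs.1, hs.2.trans_lt hy⟩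
  rw [level_of_le_beta hf (hβ x ⟨le_rfl, hxy⟩), level_of_le_beta hf (hβ x ⟨le_rfl, hxy⟩),
    level_of_le_beta hf (hβ y ⟨hxy, le_rfl⟩), level_of_le_beta hf (hβ y ⟨hxy, le_rfl⟩)]
  refine sub_le_sub_of_hasDerivAt_le hxy
    (fun s hs => hA.level_hasDerivAt hq (hI hs) (hf.F_hasDerivAt s (hA.mem s (hI hs)))
      (hA.energy_pos s (hI hs)))
    (fun s hs => hB.level_hasDerivAt hq (hI hs) (hf.F_hasDerivAt s (hA.mem s (hI hs)))
      (hB.energy_pos s (hI hs))) fun s hs => ?_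
  have hs' := hI (Ioo_subset_Icc_self hs)
  have hβs := hβ s (Ioo_subset_Icc_self hs)
  have hF := hf.F_nonpos s hβs
  obtain ⟨d1, d2⟩ := hdom s hs
  rw [level_of_le_beta hf hβs, level_of_le_beta hf hβs] at d2
  have hrA := hA.r_pos s hs'
  have hrB := hB.r_pos s hs'
  have hpA := hA.p_pos s hs'
  have hpB := hB.p_pos s hs'
  have hhA := hq.h_pos _ hrA
  have hhB := hq.h_pos _ hrB
  have hKA := hq.K_pos _ hrA
  have hKB := hq.K_pos _ hrB
  have heA := hA.energy_pos s hs'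
  have heB := hB.energy_pos s hs'
  have key : ∀ t y : ℝ, 0 < t → 0 < y → 0 < y ^ 2 + 2 * Fint f s →
      (hfun q t * Gfun q t * y - hfun q t * Fint f s / y + hInt q t * (f s - f s)) /
        √(hInt q t * (y ^ 2 + 2 * Fint f s)) =
      (Gfun q t * hfun q t / √(hInt q t)) * (y / √(y ^ 2 + 2 * Fint f s)) +
        hfun q t * (-Fint f s) / (y * √(hInt q t * (y ^ 2 + 2 * Fint f s))) := by
    intro t y ht hy he
    have h1 := (Real.sqrt_pos.2 (hq.K_pos t ht)).ne'
    have h2 := (Real.sqrt_pos.2 he).ne'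
    rw [Real.sqrt_mul (hq.K_pos t ht).le]
    field_simp
    ring
  rw [key _ _ hrA hpA heA, key _ _ hrB hpB heB]
  have h1 := hq.G_ratio_mono hrA hrB (hr s hs)
  have h2 := div_sqrt_le_div_sqrt hpB d1.le hF heB
  have h3 := hq.h_mono.monotoneOn hrA hrB (hr s hs)
  have h4 := Real.sqrt_le_sqrt d2.le
  have h5 := Real.sqrt_pos.2 (mul_pos hKB heB)
  refine add_le_add (mul_le_mul h1 h2 (by positivity) ?_) ?_
  · exact div_nonneg (mul_nonneg (hq.G_nonneg _ hrB) hhB.le) (Real.sqrt_nonneg _)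
  · exact div_le_div₀ (mul_nonneg hhB.le (neg_nonneg.2 hF))
      (mul_le_mul_of_nonneg_right h3 (neg_nonneg.2 hF)) (by positivity)
      (mul_le_mul d1.le h4 h5.le hpA.le)

lemma sqrt_level_sub_le_outer (hf : AdmissibleNonlinearity c f b β C)
    (hq : AdmissibleWeight q a C)
    (hA : Branch c f q l M rA pA) (hB : Branch c f q l M rB pB) {x y : ℝ} (hxy : x ≤ y)
    (hx : l < x) (hy : y < M) (hyβ : y ≤ -β)
    (hdom : ∀ s ∈ Ioo x y, Dominates f q rA pA rB pB s) (hr : ∀ s ∈ Ioo x y, rA s ≤ rB s) :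
    √(branchLevel f q rA pA y) - √(branchLevel f q rB pB y) ≤
      √(branchLevel f q rA pA x) - √(branchLevel f q rB pB x) := by
  have hI : Icc x y ⊆ Ioo l M := fun s hs => ⟨hx.trans_le hs.1, hs.2.trans_lt hy⟩
  have hβ : ∀ s ∈ Icc x y, β ≤ |s| := fun s hs => le_abs.2 (Or.inr (by linarith [hs.2]))
  have hlev : ∀ r p : ℝ → ℝ, Branch c f q l M r p → ∀ s ∈ Icc x y, branchLevel f q r p s =
      hInt q (r s) * (p s ^ 2 + 2 * (fun _ => (0:ℝ)) s) := fun r p h s hs => by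
    rw [h.level_of_beta_le hf (hI hs) (hβ s hs), mul_zero, add_zero]
  have hpos : ∀ r p : ℝ → ℝ, Branch c f q l M r p → ∀ s ∈ Icc x y,
      0 < p s ^ 2 + 2 * (fun _ => (0:ℝ)) s := fun r p h s hs => by
    have := h.p_pos s (hI hs)
    simp only [mul_zero, add_zero]
    positivity
  rw [hlev _ _ hA x ⟨le_rfl, hxy⟩, hlev _ _ hB x ⟨le_rfl, hxy⟩, hlev _ _ hA y ⟨hxy, le_rfl⟩,
    hlev _ _ hB y ⟨hxy, le_rfl⟩]
  refine sub_le_sub_of_hasDerivAt_le hxy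
    (fun s hs => hA.level_hasDerivAt hq (hI hs) (hasDerivAt_const s (0:ℝ)) (hpos _ _ hA s hs))
    (fun s hs => hB.level_hasDerivAt hq (hI hs) (hasDerivAt_const s (0:ℝ)) (hpos _ _ hB s hs))
    fun s hs => ?_
  have hsI := Ioo_subset_Icc_self hs
  have hs' := hI hsI
  obtain ⟨d1, d2⟩ := hdom s hs
  rw [hA.level_of_beta_le hf hs' (hβ s hsI), hB.level_of_beta_le hf hs' (hβ s hsI)] at d2
  have hrA := hA.r_pos s hs'
  have hrB := hB.r_pos s hs'
  have hpA := hA.p_pos s hs'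
  have hpB := hB.p_pos s hs'
  have hKA := hq.K_pos _ hrA
  have hKB := hq.K_pos _ hrB
  have hfs := hf.f_neg (hA.mem s hs') (by linarith [hs.2, hf.b_lt] : s < -b)
  simp only [mul_zero, add_zero, zero_div, sub_zero, zero_sub]
  have key : ∀ t y : ℝ, 0 < t → 0 < y →
      (hfun q t * Gfun q t * y + hInt q t * -f s) / √(hInt q t * y ^ 2) =
      Gfun q t * hfun q t / √(hInt q t) + hInt q t * -f s / √(hInt q t * y ^ 2) := by
    intro t y ht hy
    have h1 := (Real.sqrt_pos.2 (hq.K_pos t ht)).ne'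
    rw [Real.sqrt_mul (hq.K_pos t ht).le, Real.sqrt_sq hy.le]
    field_simp
  rw [key _ _ hrA hpA, key _ _ hrB hpB]
  have h1 := hq.G_ratio_mono hrA hrB (hr s hs)
  have h2 := hq.K_mono.monotoneOn hrA hrB (hr s hs)
  have h4 := Real.sqrt_le_sqrt d2.le
  have h5 : 0 < √(hInt q (rB s) * pB s ^ 2) := Real.sqrt_pos.2 (by positivity)
  exact add_le_add h1 (div_le_div₀ (mul_nonneg hKB.le (by linarith))
    (mul_le_mul_of_nonneg_right h2 (by linarith)) h5 h4)

end Branch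

namespace Branch

variable {c : EReal} {f q rA pA rB pB r p : ℝ → ℝ} {a b β C l M : ℝ}

lemma continuousAt_level (hf : AdmissibleNonlinearity c f b β C) (hq : AdmissibleWeight q a C)
    (h : Branch c f q l M r p) {s : ℝ} (hs : s ∈ Ioo l M) :
    ContinuousAt (branchLevel f q r p) s :=
  (h.K_hasDerivAt hq hs).continuousAt.mul (((h.p_hasDerivAt s hs).continuousAt.pow 2).add
    (((hf.F_hasDerivAt s (h.mem s hs)).continuousAt.min continuousAt_const).const_mul 2))

lemma radius_anti (h : Branch c f q l M r p) {x y : ℝ} (hx : l < x) (hxy : x ≤ y) (hy : y < M) :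
    r y ≤ r x := by
  have hI : Icc x y ⊆ Ioo l M := fun s hs => ⟨hx.trans_le hs.1, hs.2.trans_lt hy⟩
  have := sub_le_sub_of_hasDerivAt_le hxy (fun s hs => h.r_hasDerivAt s (hI hs))
    (fun s _ => hasDerivAt_const s (0:ℝ)) fun s hs => by
      have := one_div_pos.2 (h.p_pos s (hI (Ioo_subset_Icc_self hs)))
      linarith
  linarith

lemma level_le (hq : AdmissibleWeight q a C) (h : Branch c f q l M r p) {s : ℝ}
    (hs : s ∈ Ioo l M) : branchLevel f q r p s ≤ hInt q (r s) * p s ^ 2 :=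
  mul_le_mul_of_nonneg_left (by linarith [min_le_right (Fint f s) 0])
    (hq.K_pos _ (h.r_pos s hs)).le

lemma eventually_dominates (hf : AdmissibleNonlinearity c f b β C) (hq : AdmissibleWeight q a C)
    {M' : ℝ} (hA : Branch c f q l M' rA pA) (hB : Branch c f q l M rB pB) (hl : l < M)
    (hM : M < M') (hpB : Tendsto pB (𝓝[<] M) (𝓝 0)) :
    ∀ᶠ s in 𝓝[<] M, Dominates f q rA pA rB pB s := by
  have hMA : M ∈ Ioo l M' := ⟨hl, hM⟩
  have h1 : ∀ᶠ s in 𝓝[<] M, pB s < pA s := hpB.eventually_lt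
    ((hA.p_hasDerivAt M hMA).continuousAt.tendsto.mono_left nhdsWithin_le_nhds) (hA.p_pos M hMA)
  obtain ⟨s₀, hs₀⟩ := exists_between hl
  have h2 : Tendsto (fun s => hInt q (rB s₀) * pB s ^ 2) (𝓝[<] M) (𝓝 0) := by
    simpa using (hpB.pow 2).const_mul (hInt q (rB s₀))
  have h3 := h2.eventually_lt ((hA.continuousAt_level hf hq hMA).tendsto.mono_left
    nhdsWithin_le_nhds) (hA.level_pos hq hMA)
  filter_upwards [h1, h3, Ioo_mem_nhdsLT hs₀.2] with s hs1 hs3 hs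
  have hsB : s ∈ Ioo l M := ⟨hs₀.1.trans hs.1, hs.2⟩
  refine ⟨hs1, (hB.level_le hq hsB).trans_lt (lt_of_le_of_lt ?_ hs3)⟩
  exact mul_le_mul_of_nonneg_right (hq.K_mono.monotoneOn (hB.r_pos s hsB) (hB.r_pos s₀ hs₀)
    (hB.radius_anti hs₀.1 hs.1.le hs.2)) (sq_nonneg _)

lemma lt_of_level_lt (hq : AdmissibleWeight q a C) (hA : Branch c f q l M rA pA)
    (hB : Branch c f q l M rB pB) {s : ℝ} (hs : s ∈ Ioo l M) (hr : rA s ≤ rB s)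
    (hlev : branchLevel f q rB pB s < branchLevel f q rA pA s) : pB s < pA s := by
  by_contra! h
  have hpos : 0 < pA s ^ 2 + 2 * min (Fint f s) 0 :=
    (mul_pos_iff_of_pos_left (hq.K_pos _ (hA.r_pos s hs))).1 (hA.level_pos hq hs)
  have h1 : pA s ^ 2 ≤ pB s ^ 2 := pow_le_pow_left₀ (hA.p_pos s hs).le h 2
  have h2 := hq.K_mono.monotoneOn (hA.r_pos s hs) (hB.r_pos s hs) hr
  refine absurd hlev (not_lt.2 ?_)
  exact mul_le_mul h2 (by linarith) hpos.le (hq.K_pos _ (hB.r_pos s hs)).le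

lemma level_lt_of_pohozaev_lt (hf : AdmissibleNonlinearity c f b β C)
    (hq : AdmissibleWeight q a C) (hA : Branch c f q l M rA pA) (hB : Branch c f q l M rB pB)
    {s : ℝ} (hs : s ∈ Ioo l M) (hβ : β ≤ s) (hr : rA s ≤ rB s)
    (hle : branchLevel f q rB pB s ≤ branchLevel f q rA pA s)
    (hJ : branchPohozaev f q rB pB s < branchPohozaev f q rA pA s) :
    branchLevel f q rB pB s < branchLevel f q rA pA s := by
  refine lt_of_le_of_ne hle fun heq => absurd hJ (not_lt.2 ?_)
  have hβ' : β ≤ |s| := hβ.trans (le_abs_self s)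
  rw [hA.level_of_beta_le hf hs hβ', hB.level_of_beta_le hf hs hβ'] at heq
  have hF : 0 ≤ Fint f s := by
    rcases eq_or_lt_of_le hβ with h | h
    · rw [← h, hf.F_β]
    · exact (hf.F_pos s h (hA.mem s hs).2).le
  have hfs := hf.pos s (hf.b_lt.trans_le hβ) (hA.mem s hs).2
  have hKA := hq.K_pos _ (hA.r_pos s hs)
  have hKB := hq.K_pos _ (hB.r_pos s hs)
  have h1 := hq.K_mono.monotoneOn (hA.r_pos s hs) (hB.r_pos s hs) hr
  have h2 : hfun q (rB s) * pB s ≤ hfun q (rA s) * pA s := by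
    have h3 := hq.ratio_anti (hA.r_pos s hs) (hB.r_pos s hs) hr
    have h4 : √(hInt q (rB s)) * pB s = √(hInt q (rA s)) * pA s := by
      rw [← Real.sqrt_sq (hA.p_pos s hs).le, ← Real.sqrt_sq (hB.p_pos s hs).le,
        ← Real.sqrt_mul hKA.le, ← Real.sqrt_mul hKB.le, heq]
    have hsA := Real.sqrt_pos.2 hKA
    have hsB := Real.sqrt_pos.2 hKB
    calc hfun q (rB s) * pB s =
          (hfun q (rB s) / √(hInt q (rB s))) * (√(hInt q (rB s)) * pB s) := by field_simp
      _ ≤ (hfun q (rA s) / √(hInt q (rA s))) * (√(hInt q (rB s)) * pB s) :=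
          mul_le_mul_of_nonneg_right h3 (mul_nonneg hsB.le (hB.p_pos s hs).le)
      _ = hfun q (rA s) * pA s := by rw [h4]; field_simp
  have h5 : Fint f s / f s * (hfun q (rB s) * pB s) ≤ Fint f s / f s * (hfun q (rA s) * pA s) :=
    mul_le_mul_of_nonneg_left h2 (div_nonneg hF hfs.le)
  have h6 := mul_le_mul_of_nonneg_right h1 hF
  unfold branchPohozaev
  linarith

/-- Once the first branch is closer to the origin it stays so for smaller values. -/
lemma radius_lt_of_le (hA : Branch c f q l M rA pA) (hB : Branch c f q l M rB pB) {x y : ℝ}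
    (hx : l < x) (hxy : x ≤ y) (hy : y < M) (hdom : ∀ s ∈ Ioo x y, Dominates f q rA pA rB pB s)
    (hr : rA y < rB y) : rA x < rB x := by
  have := hA.radius_sub_le hB hxy hx hy fun s hs => (hdom s hs).1
  linarith

lemma level_lt_of_sqrt_sub_le (hq : AdmissibleWeight q a C)
    (hA : Branch c f q l M rA pA) {x y : ℝ}
    (hy : y ∈ Ioo l M) (hdom : Dominates f q rA pA rB pB y)
    (hle : √(branchLevel f q rA pA y) - √(branchLevel f q rB pB y) ≤
      √(branchLevel f q rA pA x) - √(branchLevel f q rB pB x)) :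
    branchLevel f q rB pB x < branchLevel f q rA pA x := by
  have h1 := (Real.sqrt_lt_sqrt_iff_of_pos (hA.level_pos hq hy)).2 hdom.2
  exact lt_of_not_ge fun h => by linarith [Real.sqrt_le_sqrt h]

/-- A branch that starts higher, with a larger value of the functional, dominates. -/
lemma dominates (hf : AdmissibleNonlinearity c f b β C) (hq : AdmissibleWeight q a C)
    {M' jB : ℝ} (hA' : Branch c f q l M' rA pA) (hB : Branch c f q l M rB pB) (hl : l < M)
    (hM : M < M') (hpB : Tendsto pB (𝓝[<] M) (𝓝 0))
    (hJB : Tendsto (branchPohozaev f q rB pB) (𝓝[<] M) (𝓝 jB))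
    (hJ : jB < branchPohozaev f q rA pA M) (hβM : β < M) :
    ∀ s ∈ Ioo l M, Dominates f q rA pA rB pB s := by
  have hA : Branch c f q l M rA pA := hA'.mono le_rfl hM.le
  refine forall_mem_Ioo_of_downward (eventually_dominates hf hq hA' hB hl hM hpB) ?_ ?_
  · intro s hs hd
    exact ((hB.p_hasDerivAt s hs).continuousAt.eventually_lt
      (hA.p_hasDerivAt s hs).continuousAt hd.1).and
      ((hB.continuousAt_level hf hq hs).eventually_lt (hA.continuousAt_level hf hq hs) hd.2)
  intro s hs hall
  rcases le_or_gt (rB s) (rA s) with hr | hr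
  · obtain ⟨y, hsy, hyM⟩ := exists_between hs.2
    have hp : pB s < pA s := by
      refine lt_of_radius_le hf hq hA hB hsy hs.1 hyM
        (fun t ht => (hall t ⟨ht.1, ht.2.trans_lt hyM⟩).1) fun t ht => ?_
      have := hA.radius_sub_le hB ht.1.le hs.1 (ht.2.trans hyM)
        fun z hz => (hall z ⟨hz.1, hz.2.trans (ht.2.trans hyM)⟩).1
      linarith
    refine ⟨hp, ?_⟩
    have hpos : 0 < pB s ^ 2 + 2 * min (Fint f s) 0 :=
      (mul_pos_iff_of_pos_left (hq.K_pos _ (hB.r_pos s hs))).1 (hB.level_pos hq hs)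
    have h1 : pB s ^ 2 < pA s ^ 2 := pow_lt_pow_left₀ hp (hB.p_pos s hs).le two_ne_zero
    exact mul_lt_mul' (hq.K_mono.monotoneOn (hB.r_pos s hs) (hA.r_pos s hs) hr)
      (by linarith) hpos.le (hq.K_pos _ (hA.r_pos s hs))
  · suffices hlev : branchLevel f q rB pB s < branchLevel f q rA pA s from
      ⟨hA.lt_of_level_lt hq hB hs hr.le hlev, hlev⟩
    have hnear : ∀ᶠ t in 𝓝[>] s, rA t < rB t :=
      eventually_nhdsWithin_of_eventually_nhds ((hA.r_hasDerivAt s hs).continuousAt.eventually_lt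
        (hB.r_hasDerivAt s hs).continuousAt hr)
    obtain ⟨w, hw, hw2⟩ := (mem_nhdsGT_iff_exists_Ioo_subset).1 hnear
    have hstep : ∀ e, s < e → ∃ y, s < y ∧ y < e ∧ y < M ∧ ∀ t ∈ Ioo s y, rA t ≤ rB t := by
      intro e he
      obtain ⟨y, hsy, hy⟩ := exists_between (lt_min (lt_min he hs.2) (mem_Ioi.1 hw))
      refine ⟨y, hsy, hy.trans_le ((min_le_left _ _).trans (min_le_left _ _)),
        hy.trans_le ((min_le_left _ _).trans (min_le_right _ _)), fun t ht => ?_⟩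
      exact le_of_lt (hw2 ⟨ht.1, ht.2.trans (hy.trans_le (min_le_right _ _))⟩)
    rcases le_or_gt β s with hβ | hβ
    · have hle : branchLevel f q rB pB s ≤ branchLevel f q rA pA s := by
        refine le_of_tendsto_of_tendsto
          ((hB.continuousAt_level hf hq hs).tendsto.mono_left (nhdsWithin_le_nhds (s := Ioi s)))
          ((hA.continuousAt_level hf hq hs).tendsto.mono_left nhdsWithin_le_nhds) ?_
        filter_upwards [Ioo_mem_nhdsGT hs.2] with t ht using (hall t ht).2.le
      refine level_lt_of_pohozaev_lt hf hq hA hB hs hβ hr.le hle ?_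
      have hlim : branchPohozaev f q rA pA M - jB ≤
          branchPohozaev f q rA pA s - branchPohozaev f q rB pB s := by
        refine le_of_tendsto (((hA'.pohozaev_hasDerivAt hf hq ⟨hl, hM⟩
          ((hf.b_lt.trans hβM).trans_le (le_abs_self _))).continuousAt.tendsto.mono_left
          nhdsWithin_le_nhds).sub hJB) ?_
        filter_upwards [Ioo_mem_nhdsLT hs.2] with y hy
        exact pohozaev_sub_le hf hq hA hB hy.1.le hs.1 hy.2
          (fun t ht => ((hf.b_lt.trans_le hβ).trans_le ht.1).trans_le (le_abs_self _))
          (fun t ht => (hβ.trans_lt ht.1).trans_le (le_abs_self _))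
          fun t ht => hall t ⟨ht.1, ht.2.trans hy.2⟩
      linarith
    · rcases le_or_gt (-β) s with hβ' | hβ'
      · obtain ⟨y, hsy, hye, hyM, hyr⟩ := hstep β hβ
        refine hA.level_lt_of_sqrt_sub_le hq ⟨hs.1.trans hsy, hyM⟩ (hall y ⟨hsy, hyM⟩)
          (sqrt_level_sub_le_inner hf hq hA hB hsy.le hs.1 hyM (fun t ht => abs_le.2
            ⟨hβ'.trans ht.1, ht.2.trans hye.le⟩) (fun t ht => hall t ⟨ht.1, ht.2.trans hyM⟩) hyr)
      · obtain ⟨y, hsy, hye, hyM, hyr⟩ := hstep (-β) hβ'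
        refine hA.level_lt_of_sqrt_sub_le hq ⟨hs.1.trans hsy, hyM⟩ (hall y ⟨hsy, hyM⟩)
          (sqrt_level_sub_le_outer hf hq hA hB hsy.le hs.1 hyM hye.le
            (fun t ht => hall t ⟨ht.1, ht.2.trans hyM⟩) hyr)

/-- A dominating branch cannot come to rest at a common minimum value. -/
lemma not_tendsto_of_dominates (hf : AdmissibleNonlinearity c f b β C)
    (hq : AdmissibleWeight q a C) (hA : Branch c f q l M rA pA) (hB : Branch c f q l M rB pB)
    (hdom : ∀ s ∈ Ioo l M, Dominates f q rA pA rB pB s) (hl : l < -β) (hM : -β < M) {B : ℝ}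
    (hrA : ∀ s ∈ Ioo l M, rA s ≤ B) : ¬ Tendsto pA (𝓝[>] l) (𝓝 0) := by
  intro hlim
  by_cases hr : ∀ s ∈ Ioo l (-β), rB s ≤ rA s
  · obtain ⟨y, hly, hy⟩ := exists_between hl
    have hd := (hdom y ⟨hly, hy.trans hM⟩).1
    have hge : ∀ᶠ s in 𝓝[>] l, pA y - pB y ≤ pA s := by
      filter_upwards [Ioo_mem_nhdsGT hly] with s hs
      have hI : Icc s y ⊆ Ioo l M := fun t ht =>
        ⟨hs.1.trans_le ht.1, ht.2.trans_lt (hy.trans hM)⟩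
      have h := sub_le_sub_of_hasDerivAt_le hs.2.le (fun t ht => hA.p_hasDerivAt t (hI ht))
        (fun t ht => hB.p_hasDerivAt t (hI ht)) fun t ht => ?_
      · linarith [hB.p_pos s (hI ⟨le_rfl, hs.2.le⟩)]
      · have ht' := hI (Ioo_subset_Icc_self ht)
        have h1 := hq.damping_anti (hB.r_pos t ht') (hA.r_pos t ht')
          (hr t ⟨ht'.1, ht.2.trans hy⟩)
        have h2 := hf.f_neg (hA.mem t ht') (by linarith [ht.2, hf.b_lt] : t < -b)
        have h3 := one_div_le_one_div_of_le (hB.p_pos t ht') (hdom t ht').1.le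
        have h4 : f t / pB t ≤ f t / pA t := by
          rw [div_eq_mul_one_div, div_eq_mul_one_div (f t) (pA t)]
          exact mul_le_mul_of_nonpos_left h3 h2.le
        linarith
    linarith [ge_of_tendsto hlim hge]
  · push Not at hr
    obtain ⟨y, hy, hry⟩ := hr
    have hyM : y < M := hy.2.trans hM
    have hd := (Real.sqrt_lt_sqrt_iff_of_pos (hA.level_pos hq ⟨hy.1, hyM⟩)).2
      (hdom y ⟨hy.1, hyM⟩).2
    have hge : ∀ᶠ s in 𝓝[>] l, √(branchLevel f q rA pA y) - √(branchLevel f q rB pB y) ≤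
        √(hInt q B * pA s ^ 2) := by
      filter_upwards [Ioo_mem_nhdsGT hy.1] with s hs
      have hsM : s ∈ Ioo l M := ⟨hs.1, hs.2.trans hyM⟩
      have h := sqrt_level_sub_le_outer hf hq hA hB hs.2.le hs.1 hyM hy.2.le
        (fun t ht => hdom t ⟨hs.1.trans ht.1, ht.2.trans hyM⟩) fun t ht =>
          (radius_lt_of_le hA hB (hs.1.trans ht.1) ht.2.le hyM
            (fun z hz => hdom z ⟨hs.1.trans (ht.1.trans hz.1), hz.2.trans hyM⟩) hry).le
      have h1 : branchLevel f q rA pA s ≤ hInt q B * pA s ^ 2 :=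
        (hA.level_le hq hsM).trans (mul_le_mul_of_nonneg_right (hq.K_mono.monotoneOn
          (hA.r_pos s hsM) ((hA.r_pos s hsM).trans_le (hrA s hsM)) (hrA s hsM)) (sq_nonneg _))
      have h2 := Real.sqrt_le_sqrt h1
      linarith [Real.sqrt_nonneg (branchLevel f q rB pB s)]
    have h0 : Tendsto (fun s => √(hInt q B * pA s ^ 2)) (𝓝[>] l) (𝓝 0) := by
      have := ((hlim.pow 2).const_mul (hInt q B)).sqrt
      simpa using this
    linarith [ge_of_tendsto h0 hge]

/-- A dominating branch that goes further down has the larger functional at the lower end of the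
other one. -/
lemma lt_pohozaev_of_dominates (hf : AdmissibleNonlinearity c f b β C)
    (hq : AdmissibleWeight q a C) {l' jB : ℝ} (hA' : Branch c f q l' M rA pA)
    (hB : Branch c f q l M rB pB) (hl' : l' < l)
    (hdom : ∀ s ∈ Ioo l M, Dominates f q rA pA rB pB s) (hl : l < -β) (hM : -β < M)
    (hJB : Tendsto (branchPohozaev f q rB pB) (𝓝[>] l) (𝓝 jB)) :
    jB < branchPohozaev f q rA pA l := by
  have hA : Branch c f q l M rA pA := hA'.mono hl'.le le_rfl
  have hβmem : -β ∈ Ioo l M := ⟨hl, hM⟩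
  have habs : |-β| = β := by rw [abs_neg, abs_of_pos hf.β_pos]
  have hβJ : ∀ r p : ℝ → ℝ, Branch c f q l M r p →
      branchPohozaev f q r p (-β) = branchLevel f q r p (-β) / 2 := by
    intro r p h
    rw [h.level_of_beta_le hf hβmem habs.ge, branchPohozaev, hf.F_even, hf.F_β]
    ring
  have h1 := (hdom _ hβmem).2
  have hlim : branchPohozaev f q rA pA (-β) - branchPohozaev f q rB pB (-β) ≤
      branchPohozaev f q rA pA l - jB := by
    have hbl : b < |l| := lt_abs.2 (Or.inr (by linarith [hf.b_lt]))
    refine ge_of_tendsto (((hA'.pohozaev_hasDerivAt hf hq ⟨hl', hl.trans hM⟩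
      hbl).continuousAt.tendsto.mono_left nhdsWithin_le_nhds).sub hJB) ?_
    filter_upwards [Ioo_mem_nhdsGT hl] with x hx
    exact pohozaev_sub_le hf hq hA hB hx.2.le hx.1 hM
      (fun t ht => lt_abs.2 (Or.inr (by linarith [hf.b_lt, ht.2])))
      (fun t ht => lt_abs.2 (Or.inr (by linarith [ht.2])))
      fun t ht => hdom t ⟨hx.1.trans ht.1, ht.2.trans hM⟩
  rw [hβJ _ _ hA, hβJ _ _ hB] at hlim
  linarith

lemma h_mul_sqrt_hasDerivAt (hf : AdmissibleNonlinearity c f b β C) (hq : AdmissibleWeight q a C)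
    (h : Branch c f q l M r p) {s : ℝ} (hs : s ∈ Ioo l M) :
    HasDerivAt (fun s => hfun q (r s) * √(p s ^ 2 + 2 * Fint f s))
      (p s / √(p s ^ 2 + 2 * Fint f s) +
        2 * deriv (hfun q) (r s) * (-Fint f s) / (p s * √(p s ^ 2 + 2 * Fint f s))) s := by
  have hp := (h.p_pos s hs).ne'
  have he := h.energy_pos s hs
  have h1 := hq.damping_mul_h _ (h.r_pos s hs)
  refine ((h.h_hasDerivAt hq hs).mul ((((h.p_hasDerivAt s hs).pow 2).add
    ((hf.F_hasDerivAt s (h.mem s hs)).const_mul 2)).sqrt he.ne')).congr_deriv ?_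
  have h5 := (Real.sqrt_pos.2 he).ne'
  have h6 := Real.sq_sqrt he.le
  simp only [Pi.pow_apply, Pi.add_apply]
  generalize √(p s ^ 2 + 2 * Fint f s) = w at *
  field_simp
  push_cast
  linear_combination (-2 * deriv (hfun q) (r s)) * h6 + (2 * p s ^ 2) * h1

/-- A dominating branch cannot be a terminal one. -/
lemma false_of_dominates (hf : AdmissibleNonlinearity c f b β C)
    (hq : AdmissibleWeight q a C) (hA : Branch c f q 0 M rA pA) (hB : Branch c f q 0 M rB pB)
    (hdom : ∀ s ∈ Ioo 0 M, Dominates f q rA pA rB pB s) (hM : β < M)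
    (hterm : ∀ ε > 0, ∀ δ > 0, ∃ s ∈ Ioo 0 M, s < δ ∧ hfun q (rA s) * pA s < ε) : False := by
  have hpos : ∀ s ∈ Ioo 0 M, 0 < hfun q (rA s) * pA s := fun s hs =>
    mul_pos (hq.h_pos _ (hA.r_pos s hs)) (hA.p_pos s hs)
  by_cases hr : ∀ s ∈ Ioo 0 β, rB s ≤ rA s
  · obtain ⟨y, hy0, hy⟩ := exists_between hf.β_pos
    have hyM : y ∈ Ioo 0 M := ⟨hy0, hy.trans hM⟩
    have hlt : hfun q (rB y) * √(pB y ^ 2 + 2 * Fint f y) <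
        hfun q (rA y) * √(pA y ^ 2 + 2 * Fint f y) := by
      refine mul_lt_mul' (hq.h_mono.monotoneOn (hB.r_pos y hyM) (hA.r_pos y hyM) (hr y ⟨hy0, hy⟩))
        (Real.sqrt_lt_sqrt (hB.energy_pos y hyM).le ?_) (Real.sqrt_nonneg _)
        (hq.h_pos _ (hA.r_pos y hyM))
      have := pow_lt_pow_left₀ (hdom y hyM).1 (hB.p_pos y hyM).le two_ne_zero
      linarith
    obtain ⟨s, hs, hsy, hsε⟩ := hterm _ (sub_pos.2 hlt) y hy0
    have hI : Icc s y ⊆ Ioo 0 M := fun t ht => ⟨hs.1.trans_le ht.1, ht.2.trans_lt hyM.2⟩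
    have h := sub_le_sub_of_hasDerivAt_le hsy.le
      (fun t ht => hA.h_mul_sqrt_hasDerivAt hf hq (hI ht))
      (fun t ht => hB.h_mul_sqrt_hasDerivAt hf hq (hI ht)) fun t ht => ?_
    · have h1 : √(pA s ^ 2 + 2 * Fint f s) ≤ pA s := by
        rw [Real.sqrt_le_left (hA.p_pos s hs).le]
        linarith [hf.F_nonpos s (abs_le.2 ⟨by linarith [hf.β_pos, hs.1], by linarith⟩)]
      have h2 := mul_le_mul_of_nonneg_left h1 (hq.h_pos _ (hA.r_pos s hs)).le
      have h3 : 0 ≤ hfun q (rB s) * √(pB s ^ 2 + 2 * Fint f s) :=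
        mul_nonneg (hq.h_pos _ (hB.r_pos s hs)).le (Real.sqrt_nonneg _)
      linarith
    · have ht' := hI (Ioo_subset_Icc_self ht)
      have htβ : t < β := ht.2.trans hy
      have hF := hf.F_nonpos t (abs_le.2 ⟨by linarith [hf.β_pos, ht'.1], htβ.le⟩)
      have hd := (hdom t ht').1
      have hpA := hA.p_pos t ht'
      have hpB := hB.p_pos t ht'
      have heB := hB.energy_pos t ht'
      have h1 := hq.h_deriv_anti (hB.r_pos t ht') (hA.r_pos t ht') (hr t ⟨ht'.1, htβ⟩)
      have h2 := hq.h_deriv_pos _ (hB.r_pos t ht')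
      have h3 := Real.sqrt_pos.2 heB
      have h4 : √(pB t ^ 2 + 2 * Fint f t) ≤ √(pA t ^ 2 + 2 * Fint f t) :=
        Real.sqrt_le_sqrt (by linarith [pow_le_pow_left₀ hpB.le hd.le 2])
      refine add_le_add (div_sqrt_le_div_sqrt hpB hd.le hF heB) ?_
      exact div_le_div₀ (mul_nonneg (by linarith) (neg_nonneg.2 hF))
        (mul_le_mul_of_nonneg_right (by linarith) (neg_nonneg.2 hF)) (by positivity)
        (mul_le_mul hd.le h4 h3.le hpA.le)
  · push Not at hr
    obtain ⟨y, hy, hry⟩ := hr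
    have hyM : y ∈ Ioo 0 M := ⟨hy.1, hy.2.trans hM⟩
    have hd := (Real.sqrt_lt_sqrt_iff_of_pos (hA.level_pos hq hyM)).2 (hdom y hyM).2
    obtain ⟨s, hs, hsy, hsε⟩ := hterm _ (half_pos (sub_pos.2 hd)) y hy.1
    have h := sqrt_level_sub_le_inner hf hq hA hB hsy.le hs.1 hyM.2
      (fun t ht => abs_le.2 ⟨by linarith [hf.β_pos, hs.1, ht.1], ht.2.trans hy.2.le⟩)
      (fun t ht => hdom t ⟨hs.1.trans ht.1, ht.2.trans hyM.2⟩) fun t ht =>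
        (radius_lt_of_le hA hB (hs.1.trans ht.1) ht.2.le hyM.2
          (fun z hz => hdom z ⟨hs.1.trans (ht.1.trans hz.1), hz.2.trans hyM.2⟩) hry).le
    have hr0 := hA.r_pos s hs
    have hh := hq.h_pos _ hr0
    have hK : hInt q (rA s) ≤ 2 * hfun q (rA s) ^ 2 := by
      have h1 := hq.G_le _ hr0
      have h2 := hq.damping_mul_h _ hr0
      have h3 := hq.h_deriv_pos _ hr0
      have h4 := hq.C_le
      rw [Gfun_eq, sub_le_iff_le_add, div_le_iff₀ hh] at h1
      have h5 : damping q (rA s) * hInt q (rA s) ≤ 2 * hfun q (rA s) := by nlinarith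
      have h6 : damping q (rA s) * hInt q (rA s) * hfun q (rA s) ≤
          2 * hfun q (rA s) * hfun q (rA s) := mul_le_mul_of_nonneg_right h5 hh.le
      nlinarith [hq.K_pos _ hr0, mul_pos h3 (hq.K_pos _ hr0)]
    have h1 : √(branchLevel f q rA pA s) ≤ 2 * (hfun q (rA s) * pA s) := by
      rw [Real.sqrt_le_left (by linarith [hpos s hs])]
      calc branchLevel f q rA pA s ≤ hInt q (rA s) * pA s ^ 2 := hA.level_le hq hs
        _ ≤ 2 * hfun q (rA s) ^ 2 * pA s ^ 2 := mul_le_mul_of_nonneg_right hK (sq_nonneg _)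
        _ ≤ (2 * (hfun q (rA s) * pA s)) ^ 2 := by nlinarith [sq_nonneg (hfun q (rA s) * pA s)]
    linarith [Real.sqrt_nonneg (branchLevel f q rB pB s)]

end Branch

/-- `u` has exactly `k` sign changes on `(R, ∞)`, starting with a nonnegative piece. -/
def SignChangesFrom (u : ℝ → ℝ) (R : ℝ) (k : ℕ) : Prop :=
  ∃ z : ℕ → ℝ, z 0 = R ∧ (∀ i, i < k → z i < z (i + 1)) ∧
    ∀ i, i ≤ k →
      (∀ r ∈ (if i < k then Icc (z i) (z (i + 1)) else Ici (z i)),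
        0 ≤ (-1 : ℝ) ^ i * u r) ∧
      ∃ r ∈ (if i < k then Icc (z i) (z (i + 1)) else Ici (z i)),
        (-1 : ℝ) ^ i * u r ≠ 0

namespace EndsAt

variable {c : EReal} {f q u v : ℝ → ℝ} {a b β C R R' : ℝ}

lemma strictAntiOn (ho : BoundOrbit c f q u v) (hR : 0 ≤ R) (he : EndsAt u v β R R') :
    StrictAntiOn u (Icc R R') := by
  apply strictAntiOn_of_deriv_neg (convex_Icc R R')
  · exact ho.continuousOn.mono fun x hx => hR.trans hx.1
  · intro x hx
    rw [interior_Icc] at hx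
    rw [(ho.hasDerivAt x (hR.trans_lt hx.1)).deriv]
    exact he.2.2.2 x hx

lemma tendsto_deriv (ho : BoundOrbit c f q u v) (hR : 0 ≤ R) (he : EndsAt u v β R R')
    (hlu : u R' < u R) :
    Tendsto (fun s => -v (descentInv u v R s)) (𝓝[>] (u R')) (𝓝 0) := by
  have h := ((ho.hasDerivAt_deriv R' (hR.trans_lt he.1)).continuousAt.tendsto.comp
    (he.descentInv_tendsto ho hR hlu)).neg
  rw [he.2.1, neg_zero] at h
  exact h

lemma pohozaev_tendsto (hf : AdmissibleNonlinearity c f b β C) (hq : AdmissibleWeight q a C)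
    (ho : BoundOrbit c f q u v) (hR : 0 ≤ R) (he : EndsAt u v β R R') (hlu : u R' < u R) :
    Tendsto (branchPohozaev f q (descentInv u v R) (fun s => -v (descentInv u v R s)))
      (𝓝[>] (u R')) (𝓝 (hInt q R' * Fint f (u R'))) := by
  have habs : b < |u R'| := by
    have h1 := neg_le_abs (u R')
    have h2 := he.2.2.1
    have h3 := hf.b_lt
    linarith
  have h := (ho.pohozaev_hasDerivAt hf hq (hR.trans_lt he.1) habs).continuousAt.tendsto.comp
    (he.descentInv_tendsto ho hR hlu)
  have h1 : pohozaev f q u v R' = hInt q R' * Fint f (u R') := by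
    simp [pohozaev, energy, he.2.1]
  rw [h1] at h
  refine h.congr' ?_
  filter_upwards [Ioo_mem_nhdsGT hlu] with s hs
  exact (BoundOrbit.branchPohozaev_eq (he.exists_eq ho hR) hs).symm

lemma not_signChangesFrom_zero (hf : AdmissibleNonlinearity c f b β C) (he : EndsAt u v β R R') :
    ¬ SignChangesFrom u R 0 := by
  rintro ⟨z, hz0, -, hz⟩
  have h := (hz 0 le_rfl).1 R' (by simpa [hz0] using he.1.le)
  have := he.2.2.1
  have := hf.β_pos
  simp only [pow_zero, one_mul] at h
  linarith

lemma signChangesFrom_neg (hf : AdmissibleNonlinearity c f b β C) (ho : BoundOrbit c f q u v)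
    (hR : 0 ≤ R) (he : EndsAt u v β R R') {j : ℕ} (hu : SignChangesFrom u R (j + 1)) :
    SignChangesFrom (-u) R' j := by
  obtain ⟨z, hz0, hz1, hz⟩ := hu
  have huR' : u R' < 0 := by linarith [he.2.2.1, hf.β_pos]
  have h0 : ∀ r ∈ Icc (z 0) (z 1), 0 ≤ u r := by simpa using (hz 0 (by lia)).1
  have h01 : z 0 < z 1 := hz1 0 (by lia)
  have h1 : z 1 < R' := by
    by_contra! h
    exact absurd (h0 R' ⟨hz0 ▸ he.1.le, h⟩) (not_le.2 huR')
  have h2 : 0 < j → R' < z 2 := by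
    intro hj
    have h12 : z 1 < z 2 := hz1 1 (by lia)
    by_contra! h
    have hn1 : ∀ r ∈ Icc (z 1) (z 2), u r ≤ 0 := by simpa [hj] using (hz 1 (by lia)).1
    have hn2 : 0 ≤ u (z 2) := by
      have h3 := (hz 2 (by lia)).1 (z 2) (by
        split_ifs with h4
        · exact ⟨le_rfl, (hz1 2 h4).le⟩
        · exact self_mem_Ici)
      simpa using h3
    have h3 := he.strictAntiOn ho hR ⟨hz0 ▸ h01.le, h1.le⟩ ⟨hz0 ▸ (h01.trans h12).le, h⟩ h12
    linarith [hn1 (z 1) ⟨le_rfl, h12.le⟩]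
  refine ⟨fun i => if i = 0 then R' else z (i + 1), if_pos rfl, ?_, ?_⟩
  · intro i hi
    rcases Nat.eq_zero_or_pos i with rfl | hi0
    · simpa using h2 hi
    · simpa [hi0.ne'] using hz1 (i + 1) (by lia)
  · intro i hi
    have hzi := hz (i + 1) (by lia)
    simp only [Nat.add_lt_add_iff_right] at hzi
    rcases Nat.eq_zero_or_pos i with rfl | hi0
    · refine ⟨fun r hr => ?_, R', ?_, by simpa using huR'.ne⟩
      · have := hzi.1 r (by
          split_ifs at hr ⊢ with h3
          · exact ⟨h1.le.trans hr.1, hr.2⟩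
          · exact h1.le.trans hr)
        simpa using this
      · split_ifs with h3
        · exact ⟨le_rfl, (h2 h3).le⟩
        · simp
    · simp only [hi0.ne', if_false, Nat.succ_ne_zero]
      simpa [pow_succ] using hzi

end EndsAt

lemma IsTerminal.not_signChangesFrom_succ {q u v : ℝ → ℝ} {R : ℝ} (ht : IsTerminal q u v R)
    {j : ℕ} : ¬ SignChangesFrom u R (j + 1) := by
  rintro ⟨z, hz0, hz1, hz⟩
  have h01 : z 0 < z 1 := hz1 0 (by lia)
  obtain ⟨hn, r, hr, hr2⟩ := hz 1 (by lia)
  have h1 : z 1 ≤ r := by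
    split_ifs at hr
    exacts [hr.1, hr]
  have h2 := hn r hr
  have h3 := ht.1 r (by linarith)
  apply hr2
  simp only [pow_one] at h2 ⊢
  linarith

lemma pohozaev_neg {c : EReal} {f q u v : ℝ → ℝ} {b β C r : ℝ}
    (hf : AdmissibleNonlinearity c f b β C) :
    pohozaev f q (-u) (-v) r = pohozaev f q u v r := by
  simp only [pohozaev, energy, Pi.neg_apply, hf.odd, hf.F_even, div_neg]
  ring

namespace BoundOrbit

variable {c : EReal} {f q uA vA uB vB : ℝ → ℝ} {a b β C RA RB : ℝ}

lemma dominates (hf : AdmissibleNonlinearity c f b β C) (hq : AdmissibleWeight q a C)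
    (hA : BoundOrbit c f q uA vA) (hB : BoundOrbit c f q uB vB) (hRA : 0 ≤ RA) (hRB : 0 ≤ RB)
    (hvB : vB RB = 0) (huB : β < uB RB) (hAB : uB RB < uA RA) {ρ l : ℝ}
    (hρ : ρ ∈ descent vA RA) (hρu : uA ρ = uB RB)
    (hJ : hInt q RB * Fint f (uB RB) < pohozaev f q uA vA ρ) (hl : l < uB RB)
    (hlA : ∀ s ∈ Ioo l (uA RA), ∃ r ∈ descent vA RA, uA r = s)
    (hlB : ∀ s ∈ Ioo l (uB RB), ∃ r ∈ descent vB RB, uB r = s) :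
    ∀ s ∈ Ioo l (uB RB), Dominates f q
      (descentInv uA vA RA) (fun s => -vA (descentInv uA vA RA s))
      (descentInv uB vB RB) (fun s => -vB (descentInv uB vB RB s)) s := by
  have ht := hB.descentInv_tendsto hf hq hRB hvB huB hl hlB
  have hle : 𝓝[>] RB ≤ 𝓝[Ici 0] RB := nhdsWithin_mono _ fun x hx => hRB.trans (le_of_lt hx)
  refine Branch.dominates hf hq (hA.branch hf hq hRA hlA) (hB.branch hf hq hRB hlB) hl hAB ?_
    (jB := hInt q RB * Fint f (uB RB)) ?_ ?_ huB
  · have h := (((hB.continuousOn_deriv RB hRB).tendsto.mono_left hle).comp ht).neg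
    rw [hvB, neg_zero] at h
    exact h
  · refine ((hB.pohozaev_tendsto hf hq hRB hvB huB).comp ht).congr' ?_
    filter_upwards [Ioo_mem_nhdsLT hl] with s hs
    exact (branchPohozaev_eq hlB hs).symm
  · rw [branchPohozaev_eq hlA ⟨hl, hAB⟩, ← hρu, hA.descentInv_apply hRA hρ, hρu]
    exact hJ

/-- Two orbits with the same number of remaining sign changes, one of which starts higher and with
a larger value of the functional, cannot both converge to `0`. -/
lemma false_of_signChangesFrom (hf : AdmissibleNonlinearity c f b β C)
    (hq : AdmissibleWeight q a C) {j : ℕ}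
    (hA : BoundOrbit c f q uA vA) (hB : BoundOrbit c f q uB vB) (hRA : 0 ≤ RA) (hRB : 0 ≤ RB)
    (hvA : vA RA = 0) (hvB : vB RB = 0) (huB : β < uB RB) (hAB : uB RB < uA RA) {ρ : ℝ}
    (hρ : ρ ∈ descent vA RA) (hρu : uA ρ = uB RB)
    (hJ : hInt q RB * Fint f (uB RB) < pohozaev f q uA vA ρ)
    (hsA : SignChangesFrom uA RA j) (hsB : SignChangesFrom uB RB j) : False := by
  have hβ := hf.β_pos
  have huA := huB.trans hAB
  induction j generalizing uA vA uB vB RA RB ρ with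
  | zero =>
    have htA : IsTerminal q uA vA RA := (hA.endsAt_or_isTerminal hf hq hRA hvA huA).resolve_left
      fun ⟨_, he⟩ => he.not_signChangesFrom_zero hf hsA
    have htB : IsTerminal q uB vB RB := (hB.endsAt_or_isTerminal hf hq hRB hvB huB).resolve_left
      fun ⟨_, he⟩ => he.not_signChangesFrom_zero hf hsB
    have hdom := dominates hf hq hA hB hRA hRB hvB huB hAB hρ hρu hJ (hβ.trans huB) htA.2.1 htB.2.1
    refine Branch.false_of_dominates hf hq ((hA.branch hf hq hRA htA.2.1).mono le_rfl hAB.le)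
      (hB.branch hf hq hRB htB.2.1) hdom huB fun ε hε δ hδ => ?_
    obtain ⟨r, hr, hr0, hrδ, hrε⟩ := htA.2.2 ε hε (min δ (uB RB)) (lt_min hδ (hβ.trans huB))
    refine ⟨uA r, ⟨hr0, hrδ.trans_le (min_le_right _ _)⟩, hrδ.trans_le (min_le_left _ _), ?_⟩
    simp only [hA.descentInv_apply hRA hr]
    exact hrε
  | succ j ih =>
    obtain ⟨RA', heA⟩ := (hA.endsAt_or_isTerminal hf hq hRA hvA huA).resolve_right
      fun ht => ht.not_signChangesFrom_succ hsA
    obtain ⟨RB', heB⟩ := (hB.endsAt_or_isTerminal hf hq hRB hvB huB).resolve_right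
      fun ht => ht.not_signChangesFrom_succ hsB
    have hmA := heA.2.2.1
    have hmB := heB.2.2.1
    have hlA := heA.exists_eq hA hRA
    have hlB := heB.exists_eq hB hRB
    have hRA' : 0 < RA' := hRA.trans_lt heA.1
    have hRB' : 0 < RB' := hRB.trans_lt heB.1
    have hlt : uA RA' < uB RB' := by
      by_contra! hle
      have hlB' : ∀ s ∈ Ioo (uA RA') (uB RB), ∃ r ∈ descent vB RB, uB r = s := fun s hs =>
        hlB s ⟨hle.trans_lt hs.1, hs.2⟩
      refine Branch.not_tendsto_of_dominates hf hq
        ((hA.branch hf hq hRA hlA).mono le_rfl hAB.le) (hB.branch hf hq hRB hlB')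
        (dominates hf hq hA hB hRA hRB hvB huB hAB hρ hρu hJ (by linarith) hlA hlB')
        hmA (by linarith) (B := RA') (fun s hs => ?_) (heA.tendsto_deriv hA hRA (by linarith))
      exact (heA.lt_of_mem_descent (descentInv_mem hlA ⟨hs.1, hs.2.trans hAB⟩)).le
    have hlA' : ∀ s ∈ Ioo (uB RB') (uA RA), ∃ r ∈ descent vA RA, uA r = s := fun s hs =>
      hlA s ⟨hlt.trans hs.1, hs.2⟩
    have hmem : uB RB' ∈ Ioo (uA RA') (uA RA) := ⟨hlt, by linarith⟩
    have hJ' := Branch.lt_pohozaev_of_dominates hf hq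
      ((hA.branch hf hq hRA hlA).mono le_rfl hAB.le) (hB.branch hf hq hRB hlB) hlt
      (dominates hf hq hA hB hRA hRB hvB huB hAB hρ hρu hJ (by linarith) hlA' hlB)
      hmB (by linarith) (heB.pohozaev_tendsto hf hq hB hRB (by linarith))
    rw [branchPohozaev_eq hlA hmem] at hJ'
    set r₁ := descentInv uA vA RA (uB RB') with hr₁
    have hr₁m : r₁ ∈ descent vA RA := descentInv_mem hlA hmem
    have hr₁u : uA r₁ = uB RB' := apply_descentInv hlA hmem
    have hr₁lt := heA.lt_of_mem_descent hr₁m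
    have hA' := hA.neg hf
    have huA' : β < (-uA) RA' := by simp only [Pi.neg_apply]; linarith
    obtain ⟨r₂, hr₂m, hr₂u⟩ : ∃ r ∈ descent (-vA) RA', (-uA) r = -(uB RB') := by
      rcases hA'.endsAt_or_isTerminal hf hq hRA'.le (by simp [heA.2.1]) huA' with ⟨R'', he⟩ | ht
      · have := he.2.2.1
        exact he.exists_eq hA' hRA'.le _ ⟨by linarith, neg_lt_neg hlt⟩
      · exact ht.2.1 _ ⟨by linarith, neg_lt_neg hlt⟩
    have hJ₂ : pohozaev f q (-uA) (-vA) r₁ ≤ pohozaev f q (-uA) (-vA) r₂ := by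
      refine hA'.pohozaev_le_of_eq hf hq (hRA.trans_lt hr₁m.1) (hr₁lt.trans hr₂m.1).le
        (fun t ht => ?_) (by rw [hr₂u, Pi.neg_apply, hr₁u])
      rcases le_total t RA' with h | h
      · have h1 := (heA.strictAntiOn hA hRA).antitoneOn ⟨hr₁m.1.le, hr₁lt.le⟩
          ⟨hr₁m.1.le.trans ht.1, h⟩ ht.1
        simp only [Pi.neg_apply]
        linarith
      · have h1 := (hA'.strictAntiOn_descent hRA'.le hr₂m).antitoneOn ⟨h, ht.2⟩
          ⟨hr₂m.1.le, le_rfl⟩ ht.2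
        linarith
    rw [pohozaev_neg hf] at hJ₂
    refine ih hA' (hB.neg hf) hRA'.le hRB'.le (by simp [heA.2.1]) (by simp [heB.2.1])
      (by simp only [Pi.neg_apply]; linarith) (by simpa using hlt) hr₂m hr₂u ?_
      (heA.signChangesFrom_neg hf hA hRA hsA) (heB.signChangesFrom_neg hf hB hRB hsB) huA'
    rw [Pi.neg_apply, hf.F_even]
    exact hJ'.trans_le hJ₂

end BoundOrbit

namespace BoundOrbit

variable {c : EReal} {f q uA vA uB vB : ℝ → ℝ} {a b β C R : ℝ}

lemma continuousWithinAt_Ici (ho : BoundOrbit c f q uA vA) (hR : 0 ≤ R) :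
    ContinuousWithinAt uA (Ici R) R ∧ ContinuousWithinAt vA (Ici R) R :=
  ⟨(ho.continuousOn R hR).mono (Ici_subset_Ici.2 hR),
    (ho.continuousOn_deriv R hR).mono (Ici_subset_Ici.2 hR)⟩

lemma exists_eqOn_of_pos (hf : AdmissibleNonlinearity c f b β C) (hq : AdmissibleWeight q a C)
    (hA : BoundOrbit c f q uA vA) (hB : BoundOrbit c f q uB vB) (hR : 0 ≤ R)
    (hu : uA R = uB R) (hv : vA R = vB R) (hpos : 0 < uA R) :
    ∃ w > R, ∀ t ∈ Icc R w, uA t = uB t ∧ vA t = vB t := by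
  obtain ⟨L, s, hs, hL⟩ := (hf.contDiffAt _ hpos (hA.mem R hR).2).exists_lipschitzOnWith
  have hnear : ∀ᶠ t in 𝓝[≥] R, uA t ∈ s ∧ uB t ∈ s :=
    ((hA.continuousWithinAt_Ici hR).1.tendsto.eventually hs).and
      ((hB.continuousWithinAt_Ici hR).1.tendsto.eventually (hu ▸ hs))
  obtain ⟨w₀, hw₀, hw₀s⟩ := mem_nhdsGE_iff_exists_Icc_subset.1 hnear
  have hL0 : (0 : ℝ) ≤ L := L.2
  set w := min w₀ (R + 1 / (L + 1)) with hw
  have hRw : R < w := lt_min hw₀ (by linarith [show (0:ℝ) < 1 / (L + 1) by positivity])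
  obtain ⟨ε, hε⟩ : ∃ ε : ℝ, ε = w - R := ⟨_, rfl⟩
  have hε0 : 0 < ε := by linarith
  have hεL : ε * (L + 1) ≤ 1 := by
    rw [← le_div_iff₀ (by positivity)]
    linarith [min_le_right w₀ (R + 1 / (L + 1))]
  have hsub : ∀ t ∈ Icc R w, 0 ≤ t := fun t ht => hR.trans ht.1
  obtain ⟨T, hT, hmax⟩ := isCompact_Icc.exists_isMaxOn (nonempty_Icc.2 hRw.le)
    (((hA.continuousOn_deriv.sub hB.continuousOn_deriv).mono hsub).abs)
  set m := |vA T - vB T| with hm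
  have hmax' : ∀ t ∈ Icc R w, |vA t - vB t| ≤ m := fun t ht => hmax ht
  have hu_le : ∀ t ∈ Icc R w, |uA t - uB t| ≤ ε * m := by
    intro t ht
    rcases eq_or_lt_of_le ht.1 with rfl | hRt
    · rw [hu, sub_self, abs_zero]; positivity
    obtain ⟨x, hx, hx2⟩ := exists_hasDerivAt_eq_slope (fun x => uA x - uB x)
      (fun x => vA x - vB x) hRt
      ((hA.continuousOn.sub hB.continuousOn).mono fun x hx => hR.trans hx.1)
      fun x hx => (hA.hasDerivAt x (hR.trans_lt hx.1)).sub (hB.hasDerivAt x (hR.trans_lt hx.1))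
    simp only [hu, sub_self, sub_zero] at hx2
    rw [eq_div_iff (by linarith)] at hx2
    rw [← hx2, abs_mul, mul_comm, abs_of_pos (sub_pos.2 hRt)]
    exact mul_le_mul (by linarith [ht.2]) (hmax' x ⟨hx.1.le, hx.2.le.trans ht.2⟩)
      (abs_nonneg _) hε0.le
  have hm0 : m = 0 := by
    rcases eq_or_lt_of_le hT.1 with hRT | hRT
    · rw [hm, ← hRT, hv, sub_self, abs_zero]
    have hsubT : ∀ x ∈ Icc R T, x ∈ Ici (0:ℝ) := fun x hx => hR.trans hx.1
    obtain ⟨x, hx, hx2⟩ := exists_hasDerivAt_eq_slope (fun x => q x * vA x - q x * vB x)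
      (fun x => -(q x * f (uA x)) - -(q x * f (uB x))) hRT
      (((hA.flux_continuousOn hq).sub (hB.flux_continuousOn hq)).mono hsubT)
      fun x hx => (hA.flux_hasDerivAt hq (hR.trans_lt hx.1)).sub
        (hB.flux_hasDerivAt hq (hR.trans_lt hx.1))
    simp only [hv, sub_self, sub_zero] at hx2
    rw [eq_div_iff (by linarith)] at hx2
    have hxw : x ∈ Icc R w := ⟨hx.1.le, hx.2.le.trans hT.2⟩
    have hx0 := hR.trans_lt hx.1
    have hqx := hq.pos x hx0
    have hqT := hq.pos T (hR.trans_lt hRT)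
    have hqle : q x ≤ q T := hq.strictMonoOn.monotoneOn hx0.le (hR.trans hT.1) hx.2.le
    have hfl : |f (uA x) - f (uB x)| ≤ L * (ε * m) := by
      have h := hL.dist_le_mul _ (hw₀s ⟨hxw.1, hxw.2.trans (min_le_left _ _)⟩).1
        _ (hw₀s ⟨hxw.1, hxw.2.trans (min_le_left _ _)⟩).2
      rw [Real.dist_eq, Real.dist_eq] at h
      exact h.trans (mul_le_mul_of_nonneg_left (hu_le x hxw) hL0)
    have h1 : q T * m = q x * |f (uA x) - f (uB x)| * (T - R) := by
      rw [hm, ← abs_of_pos hqT, ← abs_mul, ← abs_of_pos hqx, ← abs_mul,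
        ← abs_of_pos (sub_pos.2 hRT), ← abs_mul, mul_sub, ← hx2, ← abs_neg]
      congr 1
      ring
    have hm0 : 0 ≤ m := abs_nonneg _
    have h2 : q T * m ≤ q T * (L * (ε * m) * ε) := by
      rw [h1, mul_assoc]
      exact mul_le_mul hqle (mul_le_mul hfl (by linarith [hT.2]) (by linarith) (by positivity))
        (mul_nonneg (abs_nonneg _) (by linarith)) hqT.le
    have h3 := le_of_mul_le_mul_left h2 hqT
    by_contra hne
    have hmpos : 0 < m := lt_of_le_of_ne hm0 (Ne.symm hne)
    have h4 : 1 ≤ L * ε * ε := by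
      by_contra! h
      nlinarith
    nlinarith
  refine ⟨w, hRw, fun t ht => ⟨?_, ?_⟩⟩
  · have h := hu_le t ht
    rw [hm0, mul_zero] at h
    exact sub_eq_zero.1 (abs_nonpos_iff.1 h)
  · have h := hmax' t ht
    rw [hm0] at h
    exact sub_eq_zero.1 (abs_nonpos_iff.1 h)

lemma exists_eqOn_of_deriv_ne (hf : AdmissibleNonlinearity c f b β C)
    (hq : AdmissibleWeight q a C) (hA : BoundOrbit c f q uA vA) (hB : BoundOrbit c f q uB vB)
    (hR : 0 < R) (hu : uA R = uB R) (hv : vA R = vB R) (hne : vA R ≠ 0) :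
    ∃ w > R, ∀ t ∈ Icc R w, uA t = uB t ∧ vA t = vB t := by
  have hmem := hA.mem R hR.le
  have hF : HasStrictDerivAt (Fint f) (f (uA R)) (uA R) :=
    hasStrictDerivAt_of_hasDerivAt_of_continuousAt
      (by filter_upwards [(isOpen_inCC c).mem_nhds hmem] with s hs using hf.F_hasDerivAt s hs)
      (hf.continuousAt _ hmem)
  obtain ⟨L, s, hs, hL⟩ := hF.hasStrictFDerivAt.exists_lipschitzOnWith
  have hV : 0 < |vA R| := abs_pos.2 hne
  have hsum : ContinuousWithinAt (fun t => |vA t + vB t|) (Ici R) R :=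
    ((hA.continuousWithinAt_Ici hR.le).2.add (hB.continuousWithinAt_Ici hR.le).2).abs
  have hnear : ∀ᶠ t in 𝓝[≥] R, uA t ∈ s ∧ uB t ∈ s ∧ |vA R| < |vA t + vB t| := by
    refine ((hA.continuousWithinAt_Ici hR.le).1.tendsto.eventually hs).and
      (((hB.continuousWithinAt_Ici hR.le).1.tendsto.eventually (hu ▸ hs)).and
      (hsum.tendsto.eventually (lt_mem_nhds ?_)))
    rw [← hv, ← two_mul, abs_mul, abs_two]
    linarith
  obtain ⟨w, hw, hws⟩ := mem_nhdsGE_iff_exists_Icc_subset.1 hnear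
  have hRw : R < w := hw
  have hdiff : ∀ t, vA t ^ 2 - vB t ^ 2 = 2 * ((energy f uA vA t - energy f uB vB t) -
      (Fint f (uA t) - Fint f (uB t))) := by
    intro t
    unfold energy
    ring
  have hsq : ∀ t ∈ Icc R w, |vA t ^ 2 - vB t ^ 2| ≤
      2 * (1 + L) * ‖(uA t - uB t, energy f uA vA t - energy f uB vB t)‖ := by
    intro t ht
    obtain ⟨h1, h2, -⟩ := hws ht
    have h3 := hL.dist_le_mul _ h1 _ h2
    rw [Real.dist_eq, Real.dist_eq] at h3
    have h4 := norm_fst_le (uA t - uB t, energy f uA vA t - energy f uB vB t)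
    have h5 := norm_snd_le (uA t - uB t, energy f uA vA t - energy f uB vB t)
    simp only [Real.norm_eq_abs] at h4 h5
    have h6 := mul_le_mul_of_nonneg_left h4 L.2
    rw [hdiff, abs_mul, abs_two]
    have h7 := abs_sub (energy f uA vA t - energy f uB vB t) (Fint f (uA t) - Fint f (uB t))
    change (L:ℝ) * _ ≤ L * _ at h6
    linarith
  have hvdiff : ∀ t ∈ Icc R w, |vA t - vB t| ≤ |vA t ^ 2 - vB t ^ 2| / |vA R| := by
    intro t ht
    rw [le_div_iff₀ hV, show vA t ^ 2 - vB t ^ 2 = (vA t - vB t) * (vA t + vB t) by ring, abs_mul]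
    exact mul_le_mul_of_nonneg_left (hws ht).2.2.le (abs_nonneg _)
  have hzero : ∀ t ∈ Icc R w, (uA t - uB t, energy f uA vA t - energy f uB vB t) = (0, 0) := by
    refine eq_zero_of_abs_deriv_le_mul_abs_self_of_eq_zero_right
      (f' := fun t => (vA t - vB t, -(damping q t * vA t ^ 2) - -(damping q t * vB t ^ 2)))
      (K := 2 * (1 + L) * (1 / |vA R| + damping q R)) ?_ ?_ ?_ ?_
    · have hsub : ∀ t ∈ Icc R w, t ∈ Ici (0:ℝ) := fun t ht => hR.le.trans ht.1
      exact ((hA.continuousOn.sub hB.continuousOn).mono hsub).prodMk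
        (((hA.energy_continuousOn hf).sub (hB.energy_continuousOn hf)).mono hsub)
    · intro t ht
      have ht0 := hR.trans_le ht.1
      exact (((hA.hasDerivAt t ht0).sub (hB.hasDerivAt t ht0)).prodMk
        ((hA.energy_hasDerivAt hf ht0).sub (hB.energy_hasDerivAt hf ht0))).hasDerivWithinAt
    · simp [hu, hv, energy]
    · intro t ht
      have ht' : t ∈ Icc R w := ⟨ht.1, ht.2.le⟩
      have ht0 := hR.trans_le ht.1
      have hκ := hq.damping_anti hR ht0 ht.1
      have hκ0 := hq.damping_pos t ht0
      have hκR := hq.damping_pos R hR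
      have h1 := hsq t ht'
      set X := ‖(uA t - uB t, energy f uA vA t - energy f uB vB t)‖ with hX
      have hX0 : 0 ≤ X := norm_nonneg _
      have hL0 : (0:ℝ) ≤ L := L.2
      have h2 : |vA t ^ 2 - vB t ^ 2| / |vA R| ≤ 2 * (1 + L) * X * (1 / |vA R|) := by
        rw [div_eq_mul_one_div]
        exact mul_le_mul_of_nonneg_right h1 (by positivity)
      have h3 : damping q t * |vA t ^ 2 - vB t ^ 2| ≤ damping q R * (2 * (1 + L) * X) :=
        mul_le_mul hκ h1 (abs_nonneg _) hκR.le
      have h4 : 0 ≤ 2 * (1 + L) * X * (1 / |vA R|) := by positivity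
      have h5 : 0 ≤ damping q R * (2 * (1 + L) * X) := by positivity
      refine norm_prod_le_iff.2 ⟨?_, ?_⟩
      · rw [Real.norm_eq_abs]
        linarith [hvdiff t ht']
      · rw [Real.norm_eq_abs, show -(damping q t * vA t ^ 2) - -(damping q t * vB t ^ 2) =
          -(damping q t * (vA t ^ 2 - vB t ^ 2)) by ring, abs_neg, abs_mul, abs_of_pos hκ0]
        linarith
  refine ⟨w, hRw, fun t ht => ⟨sub_eq_zero.1 (Prod.ext_iff.1 (hzero t ht)).1, ?_⟩⟩
  have h1 := hsq t ht
  have h2 := hvdiff t ht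
  rw [hzero t ht, Prod.mk_zero_zero, norm_zero, mul_zero] at h1
  rw [abs_nonpos_iff.1 h1, abs_zero, zero_div] at h2
  exact sub_eq_zero.1 (abs_nonpos_iff.1 h2)

lemma exists_eqOn (hf : AdmissibleNonlinearity c f b β C) (hq : AdmissibleWeight q a C)
    (hA : BoundOrbit c f q uA vA) (hB : BoundOrbit c f q uB vB) (hR : 0 ≤ R)
    (hu : uA R = uB R) (hv : vA R = vB R) :
    ∃ w > R, ∀ t ∈ Icc R w, uA t = uB t ∧ vA t = vB t := by
  rcases lt_trichotomy (uA R) 0 with h | h | h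
  · obtain ⟨w, hw, hw2⟩ := exists_eqOn_of_pos hf hq (hA.neg hf) (hB.neg hf) hR
      (by simpa using hu) (by simpa using hv) (by simpa using h)
    exact ⟨w, hw, fun t ht => by simpa using hw2 t ht⟩
  · by_cases hv0 : vA R = 0
    · have hE : ∀ u v : ℝ → ℝ, u R = 0 → v R = 0 → energy f u v R = 0 := by
        intro u v h1 h2
        simp [energy, h1, h2, Fint]
      refine ⟨R + 1, by simp, fun t ht => ?_⟩
      obtain ⟨h1, h2⟩ := hA.eq_zero_of_energy_eq_zero hf hq hR (hE _ _ h hv0) ht.1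
      obtain ⟨h3, h4⟩ := hB.eq_zero_of_energy_eq_zero hf hq hR (hE _ _ (hu ▸ h) (hv ▸ hv0)) ht.1
      exact ⟨h1.trans h3.symm, h2.trans h4.symm⟩
    · have hR0 : 0 < R := lt_of_le_of_ne hR fun h0 => hv0 (h0 ▸ hA.deriv_zero)
      exact exists_eqOn_of_deriv_ne hf hq hA hB hR0 hu hv hv0
  · exact exists_eqOn_of_pos hf hq hA hB hR hu hv h

/-- An orbit is determined by its initial value. -/
lemma eqOn_of_eq_zero (hf : AdmissibleNonlinearity c f b β C) (hq : AdmissibleWeight q a C)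
    (hA : BoundOrbit c f q uA vA) (hB : BoundOrbit c f q uB vB) (hu : uA 0 = uB 0)
    {r : ℝ} (hr : 0 ≤ r) : uA r = uB r := by
  have hsub : ∀ t ∈ Icc 0 r, t ∈ Ici (0:ℝ) := fun t ht => ht.1
  have hcl : IsClosed ({t | uA t = uB t ∧ vA t = vB t} ∩ Icc 0 r) := by
    have h := (((hA.continuousOn.sub hB.continuousOn).prodMk
      (hA.continuousOn_deriv.sub hB.continuousOn_deriv)).mono hsub).preimage_isClosed_of_isClosed
      isClosed_Icc (isClosed_singleton (x := ((0, 0) : ℝ × ℝ)))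
    convert h using 1
    ext t
    simp [sub_eq_zero, and_comm]
  refine (hcl.Icc_subset_of_forall_exists_gt ⟨hu, hA.deriv_zero.trans hB.deriv_zero.symm⟩
    (fun x hx y hy => ?_) (right_mem_Icc.2 hr)).1
  obtain ⟨w, hw, hw2⟩ := exists_eqOn hf hq hA hB hx.2.1 hx.1.1 hx.1.2
  have hy : x < y := hy
  exact ⟨min w y, hw2 _ ⟨(lt_min hw hy).le, min_le_left _ _⟩, lt_min hw hy, min_le_right _ _⟩

end BoundOrbit

lemma CondF2.exists_tendsto {c : EReal} {f : ℝ → ℝ} (hc : 0 < c) (hf : CondF2 c f) :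
    ∃ L, Tendsto f (𝓝[>] 0) (𝓝 L) := by
  obtain ⟨hf1, hf2⟩ := hf
  obtain ⟨y, hy0, hyc⟩ := EReal.exists_rat_btwn_of_lt (lt_min hc (zero_lt_one' EReal))
  obtain ⟨x₀, hx₀⟩ : ∃ x₀ : ℝ, x₀ = y := ⟨_, rfl⟩
  have hx0 : 0 < x₀ := by
    rw [hx₀]
    exact_mod_cast hy0
  have hxc : (x₀ : EReal) < c := by
    rw [hx₀]
    exact hyc.trans_le (min_le_left _ _)
  have hx1 : x₀ < 1 := by
    rw [hx₀, ← EReal.coe_lt_coe_iff]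
    exact hyc.trans_le (min_le_right _ _)
  have hopen : IsOpen {s : ℝ | 0 < s ∧ (s : EReal) < c} :=
    isOpen_Ioi.inter (isOpen_lt continuous_coe_real_ereal continuous_const)
  have hInteg : IntegrableOn (deriv f) (Icc 0 x₀) := by
    rw [integrableOn_Icc_iff_integrableOn_Ioc]
    exact hf2.mono_set fun x hx => ⟨hx.1, hx.2.trans_lt hx1⟩
  have hprim : ContinuousOn (fun x => ∫ t in x..x₀, deriv f t) (Icc 0 x₀) := by
    have h := intervalIntegral.continuousOn_primitive_interval_left (a := 0) (b := x₀)
      (f := deriv f) (μ := volume) (by rwa [uIcc_of_le hx0.le])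
    rwa [uIcc_of_le hx0.le] at h
  have hmem : ∀ x ∈ Ioc 0 x₀, 0 < x ∧ (x : EReal) < c := fun x hx =>
    ⟨hx.1, lt_of_le_of_lt (EReal.coe_le_coe_iff.2 hx.2) hxc⟩
  have hd : ∀ x ∈ Ioc 0 x₀, HasDerivAt f (deriv f x) x := fun x hx =>
    ((hf1.contDiffAt (hopen.mem_nhds (hmem x hx))).differentiableAt (by norm_num)).hasDerivAt
  have heq : ∀ x ∈ Ioc 0 x₀, f x = f x₀ - ∫ t in x..x₀, deriv f t := by
    intro x hx
    have h := intervalIntegral.integral_eq_sub_of_hasDerivAt (a := x) (b := x₀) (f := f)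
      (f' := deriv f)
      (fun t ht => by
        rw [uIcc_of_le hx.2] at ht
        exact hd t ⟨hx.1.trans_le ht.1, ht.2⟩)
      (by
        rw [intervalIntegrable_iff_integrableOn_Icc_of_le hx.2]
        exact hInteg.mono_set (Icc_subset_Icc_left hx.1.le))
    rw [h]
    ring
  refine ⟨f x₀ - ∫ t in (0:ℝ)..x₀, deriv f t, ?_⟩
  have h := ((hprim 0 ⟨le_rfl, hx0.le⟩).mono_of_mem_nhdsWithin (mem_of_superset
    (Ioc_mem_nhdsGT hx0) Ioc_subset_Icc_self)).tendsto.const_sub (f x₀)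
  refine h.congr' ?_
  filter_upwards [Ioc_mem_nhdsGT hx0] with x hx using (heq x hx).symm

lemma ExactSignChanges.exists_first_zero {u : ℝ → ℝ} {k : ℕ} (hk : 1 ≤ k)
    (hu : ExactSignChanges u k) (hcont : ContinuousOn u (Ici 0)) (h0 : 0 < u 0) :
    ∃ ζ > 0, u ζ = 0 ∧ ∀ t ∈ Ico 0 ζ, 0 < u t := by
  obtain ⟨z, hz0, hz1, hz⟩ := hu
  have h01 : 0 < z 1 := hz0 ▸ hz1 0 (by lia)
  have h1 : 0 ≤ u (z 1) := by
    have h := (hz 0 (by lia)).1 (z 1)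
    rw [if_pos (by lia)] at h
    simpa using h ⟨by simpa [hz0] using h01.le, le_rfl⟩
  have h2 : u (z 1) ≤ 0 := by
    have h := (hz 1 hk).1 (z 1) (by
      split_ifs with h3
      exacts [⟨le_rfl, (hz1 1 h3).le⟩, self_mem_Ici])
    simpa using h
  have hcl : IsCompact (Icc 0 (z 1) ∩ u ⁻¹' {0}) :=
    isCompact_Icc.of_isClosed_subset
      ((hcont.mono fun t (ht : t ∈ Icc 0 (z 1)) => ht.1).preimage_isClosed_of_isClosed
        isClosed_Icc isClosed_singleton) inter_subset_left
  obtain ⟨ζ, hζ, hleast⟩ := hcl.exists_isLeast ⟨z 1, ⟨h01.le, le_rfl⟩, le_antisymm h2 h1⟩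
  have hζ0 : u ζ = 0 := hζ.2
  have hζpos : 0 < ζ := lt_of_le_of_ne hζ.1.1 fun h => by
    rw [← h] at hζ0
    exact h0.ne' hζ0
  refine ⟨ζ, hζpos, hζ0, fun t ht => ?_⟩
  by_contra! hle
  obtain ⟨x, hx, hx0⟩ := intermediate_value_Icc' ht.1
    (hcont.mono fun x (hx : x ∈ Icc 0 t) => hx.1) ⟨hle, h0.le⟩
  have := hleast ⟨⟨hx.1, hx.2.trans (ht.2.le.trans hζ.1.2)⟩, hx0⟩
  linarith [hx.2, ht.2]

/-- A solution that reaches zero after being positive forces `f` to be continuous at zero. -/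
lemma continuousAt_zero_of_exactSignChanges {c : EReal} {f q u : ℝ → ℝ} {b β a C : ℝ} {k : ℕ}
    (hc : 0 < c) (hk : 1 ≤ k) (hf1 : CondF1 c f b β) (hf2 : CondF2 c f)
    (hq : AdmissibleWeight q a C) (hu : IsSolutionE c f q u) (h0 : 0 < u 0)
    (hs : ExactSignChanges u k) : ContinuousAt f 0 := by
  obtain ⟨L, hL⟩ := hf2.exists_tendsto hc
  have hcu : ContinuousOn u (Ici 0) := hu.c1.continuousOn
  obtain ⟨ζ, hζ, huζ, hpos⟩ := hs.exists_first_zero hk hcu h0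
  have hut : Tendsto u (𝓝[<] ζ) (𝓝[>] 0) := by
    refine tendsto_nhdsWithin_iff.2 ⟨?_, ?_⟩
    · have h := (hcu.continuousAt (Ici_mem_nhds hζ)).tendsto.mono_left
        (nhdsWithin_le_nhds (s := Iio ζ))
      rwa [huζ] at h
    · filter_upwards [Ioo_mem_nhdsLT hζ] with t ht using hpos t ⟨ht.1.le, ht.2⟩
  have hv : ContinuousAt (deriv u) ζ := (hu.diff2 ζ hζ).continuousAt
  have hκ : ContinuousAt (fun r => deriv q r / q r) ζ :=
    (hq.continuousOn_deriv.continuousAt (Ioi_mem_nhds hζ)).div (hq.hasDerivAt ζ hζ).continuousAt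
      (hq.pos ζ hζ).ne'
  have hlim : Tendsto (fun r => deriv (deriv u) r) (𝓝[<] ζ)
      (𝓝 (-(deriv q ζ / q ζ * deriv u ζ) - L)) := by
    refine (((hκ.mul hv).neg.tendsto.mono_left nhdsWithin_le_nhds).sub (hL.comp hut)).congr' ?_
    filter_upwards [Ioo_mem_nhdsLT hζ] with r hr
    have := hu.ode r hr.1
    simp only [Function.comp_apply, Pi.neg_apply, Pi.mul_apply]
    linarith
  have h1 : HasDerivWithinAt (deriv u) (-(deriv q ζ / q ζ * deriv u ζ) - L) (Iic ζ) ζ :=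
    hasDerivWithinAt_Iic_of_tendsto_deriv (s := Ioo 0 ζ)
      (fun r hr => (hu.diff2 r hr.1).differentiableWithinAt) hv.continuousWithinAt
      (Ioo_mem_nhdsLT hζ) hlim
  have h2 := (hu.diff2 ζ hζ).hasDerivAt.hasDerivWithinAt (s := Iic ζ)
  have h3 := (uniqueDiffWithinAt_Iic ζ).eq_deriv _ h1 h2
  have h4 := hu.ode ζ hζ
  rw [huζ, hf1.2.1] at h4
  have hL0 : L = 0 := by linarith
  rw [hL0] at hL
  have hneg : Tendsto (fun s => -f (-s)) (𝓝[<] 0) (𝓝 0) := by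
    have h : Tendsto (fun s : ℝ => -s) (𝓝[<] 0) (𝓝[>] 0) := by
      simpa using tendsto_neg_nhdsLT (a := (0:ℝ))
    simpa using (hL.comp h).neg
  simp only [hf1.1, neg_neg] at hneg
  refine continuousAt_iff_continuous_left'_right'.2 ⟨?_, ?_⟩
  · rw [ContinuousWithinAt, hf1.2.1]; exact hneg
  · rw [ContinuousWithinAt, hf1.2.1]; exact hL

/-- Under (f1), (f2), (f7) and (q1), (q2), (q4), (q6), (q7), for
each `k ≥ 1` the bound state problem has at most one solution with positive
initial value and exactly `k` sign changes. -/
theorem uniqueness_kth_bound_state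
    (k : ℕ) (hk : 1 ≤ k)
    (c : EReal) (f q : ℝ → ℝ) (b β linf Gbar C : ℝ) (hc : 0 < c)
    (hf1 : CondF1 c f b β) (hf2 : CondF2 c f)
    (hq1 : CondQ1 q) (hq2 : CondQ2 q) (hq4 : CondQ4 q linf)
    (hq6 : CondQ6 q Gbar) (hq7 : CondQ7 q Gbar C)
    (hf7 : CondF7 c f β C)
    (u₁ u₂ : ℝ → ℝ)
    (hu₁ : IsSolutionE c f q u₁) (hu₂ : IsSolutionE c f q u₂)
    (hinit₁ : 0 < u₁ 0) (hinit₂ : 0 < u₂ 0)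
    (hlim₁ : Tendsto u₁ atTop (nhds 0)) (hlim₂ : Tendsto u₂ atTop (nhds 0))
    (hsc₁ : ExactSignChanges u₁ k) (hsc₂ : ExactSignChanges u₂ k) :
    ∀ r : ℝ, 0 ≤ r → u₁ r = u₂ r := by
  obtain ⟨a, hq⟩ := admissibleWeight hq1 hq2 hq4 hq6 hq7
  have hf := admissibleNonlinearity hf1 hf2 hf7
    (continuousAt_zero_of_exactSignChanges hc hk hf1 hf2 hq hu₁ hinit₁ hsc₁)
  have key : ∀ uA uB : ℝ → ℝ, IsSolutionE c f q uA → IsSolutionE c f q uB → 0 < uB 0 →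
      Tendsto uA atTop (𝓝 0) → Tendsto uB atTop (𝓝 0) → ExactSignChanges uA k →
      ExactSignChanges uB k → ¬ uB 0 < uA 0 := by
    intro uA uB hA hB hB0 hlA hlB hsA hsB hlt
    have hoA := boundOrbit_of_isSolutionE hf hq hA hlA
    have hoB := boundOrbit_of_isSolutionE hf hq hB hlB
    have hβB : β < uB 0 := by
      have h := hoB.lt_abs_of_deriv_eq_zero hf hq le_rfl hoB.deriv_zero hB0.ne'
      rwa [abs_of_pos hB0] at h
    obtain ⟨ρ, hρ, hρu⟩ : ∃ ρ ∈ descent (deriv uA) 0, uA ρ = uB 0 := by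
      rcases hoA.endsAt_or_isTerminal hf hq le_rfl hoA.deriv_zero (hβB.trans hlt) with ⟨R, he⟩ | ht
      · exact he.exists_eq hoA le_rfl _ ⟨by linarith [he.2.2.1, hf.β_pos], hlt⟩
      · exact ht.2.1 _ ⟨hB0, hlt⟩
    refine BoundOrbit.false_of_signChangesFrom hf hq hoA hoB le_rfl le_rfl hoA.deriv_zero
      hoB.deriv_zero hβB hlt hρ hρu ?_ hsA hsB
    simpa [hInt] using hoA.pohozaev_pos hf hq hρ (hρu ▸ hβB)
  intro r hr
  refine (boundOrbit_of_isSolutionE hf hq hu₁ hlim₁).eqOn_of_eq_zero hf hq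
    (boundOrbit_of_isSolutionE hf hq hu₂ hlim₂) (le_antisymm ?_ ?_) hr
  · exact not_lt.1 (key u₁ u₂ hu₁ hu₂ hinit₂ hlim₁ hlim₂ hsc₁ hsc₂)
  · exact not_lt.1 (key u₂ u₁ hu₂ hu₁ hinit₁ hlim₂ hlim₁ hsc₂ hsc₁)
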